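/- arXiv:2511.11544 — 2 statements merged into one kernel-verified Lean document; each statement's English description precedes it below -/
import Mathlib

section
/- Let p > 5 be a prime with p ≡ 2 or 3 (mod 5), and let G = PSL(2, p). If x, y ∈ G satisfy Sol_G(x) = Sol_G(y), then x and y are contained in exactly the same maximal subgroups of G; that is, for every maximal subgroup M of G, x ∈ M if and only if y ∈ M. -/
/-- The solvabilizer of an element `x` of a group `G`:
the set of `y ∈ G` such that `⟨x, y⟩` is solvable. -/
def solvabilizer {G : Type*} [Group G] (x : G) : Set G :=
  {y | IsSolvable ↥(Subgroup.closure {x, y})}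

/-- The projective special linear group `PSL(n, R)`. -/
noncomputable abbrev PSL (n : ℕ) (R : Type*) [CommRing R] : Type _ :=
  Matrix.SpecialLinearGroup (Fin n) R ⧸
    Subgroup.center (Matrix.SpecialLinearGroup (Fin n) R)


namespace PSLsol
open Matrix

abbrev M2 (F : Type*) := Matrix (Fin 2) (Fin 2) F
abbrev SL2 (F : Type*) [CommRing F] := Matrix.SpecialLinearGroup (Fin 2) F

set_option linter.unusedSectionVars false
set_option linter.unusedSimpArgs false

section generic
variable {F : Type*} [Field F]

lemma m2_ext {X Y : M2 F} (h00 : X 0 0 = Y 0 0) (h01 : X 0 1 = Y 0 1) (h10 : X 1 0 = Y 1 0)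
    (h11 : X 1 1 = Y 1 1) : X = Y := by
  ext i j
  fin_cases i <;> fin_cases j <;> assumption

lemma m2_ext_iff {X Y : M2 F} : X = Y ↔ X 0 0 = Y 0 0 ∧ X 0 1 = Y 0 1 ∧ X 1 0 = Y 1 0 ∧
    X 1 1 = Y 1 1 :=
  ⟨by rintro rfl; simp, fun h => m2_ext h.1 h.2.1 h.2.2.1 h.2.2.2⟩

lemma mul_ap (X Y : M2 F) (i j : Fin 2) : (X * Y) i j = X i 0 * Y 0 j + X i 1 * Y 1 j := by
  simp [Matrix.mul_apply, Fin.sum_univ_two]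

lemma one00 : (1 : M2 F) 0 0 = 1 := rfl
lemma one01 : (1 : M2 F) 0 1 = 0 := rfl
lemma one10 : (1 : M2 F) 1 0 = 0 := rfl
lemma one11 : (1 : M2 F) 1 1 = 1 := rfl

lemma sl_det (x : SL2 F) : x.1 0 0 * x.1 1 1 - x.1 0 1 * x.1 1 0 = 1 := by
  rw [← Matrix.det_fin_two]; exact x.2

lemma sl_ext {x y : SL2 F} (h : x.1 = y.1) : x = y := Subtype.ext h

lemma inv_val (x : SL2 F) : (x⁻¹).1 = !![x.1 1 1, -x.1 0 1; -x.1 1 0, x.1 0 0] := by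
  rw [Matrix.SpecialLinearGroup.SL2_inv_expl]; rfl

lemma inv_val' (x : SL2 F) : (x⁻¹).1 = x.1.trace • (1 : M2 F) - x.1 := by
  rw [inv_val]
  apply m2_ext <;> simp [Matrix.trace_fin_two]

lemma mul_val (x y : SL2 F) : (x * y).1 = x.1 * y.1 := rfl
lemma one_val : (1 : SL2 F).1 = 1 := rfl
lemma neg_val (x : SL2 F) : (-x).1 = - x.1 := rfl

/-- Cayley-Hamilton. -/
lemma sl_sq (x : SL2 F) : x.1 * x.1 = x.1.trace • x.1 - 1 := by
  have := sl_det x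
  apply m2_ext <;> simp [mul_ap, Matrix.trace_fin_two] <;> grind

/-- Constructor for elements of `SL2`. -/
def mk (a b c d : F) (h : a * d - b * c = 1) : SL2 F :=
  ⟨!![a, b; c, d], by rw [Matrix.det_fin_two]; exact h⟩

@[simp] lemma mk_val (a b c d : F) (h : a * d - b * c = 1) : (mk a b c d h).1 = !![a, b; c, d] := rfl

/-- Noncentral elements. -/
def NC (x : SL2 F) : Prop := x ≠ 1 ∧ x ≠ -1

lemma nc_of_nonscalar {x : SL2 F} : NC x ↔ ∀ a : F, x.1 ≠ a • (1 : M2 F) := by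
  constructor
  · rintro ⟨h1, h2⟩ a h
    have hd := sl_det x
    rw [h] at hd
    simp at hd
    have : a = 1 ∨ a = -1 := by
      have : (a - 1) * (a + 1) = 0 := by grind
      rcases mul_eq_zero.1 this with h | h
      · left; grind
      · right; grind
    rcases this with rfl | rfl
    · exact h1 (sl_ext (by rw [h]; simp))
    · exact h2 (sl_ext (by rw [h, neg_val]; simp))
  · intro h
    constructor
    · rintro rfl; exact h 1 (by simp)
    · rintro rfl; exact h (-1) (by simp)

/-- A matrix commuting with a non-scalar matrix `X` is a combination of `1` and `X`. -/
lemma comm_comb {X Y : M2 F} (hX : ∀ a : F, X ≠ a • (1 : M2 F)) (h : Y * X = X * Y) :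
    ∃ a b : F, Y = a • (1 : M2 F) + b • X := by
  rw [m2_ext_iff] at h
  simp only [mul_ap] at h
  obtain ⟨e1, e2, e3, e4⟩ := h
  by_cases hq : X 0 1 = 0
  · by_cases hr : X 1 0 = 0
    · have hps : X 0 0 - X 1 1 ≠ 0 := by
        intro h
        apply hX (X 0 0)
        apply m2_ext <;> simp [hq, hr]
        grind
      refine ⟨Y 0 0 - (Y 0 0 - Y 1 1) / (X 0 0 - X 1 1) * X 0 0, (Y 0 0 - Y 1 1) / (X 0 0 - X 1 1), ?_⟩
      apply m2_ext <;> simp [hq, hr]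
      · grind
      · grind
      · grind
    · refine ⟨Y 0 0 - Y 1 0 / X 1 0 * X 0 0, Y 1 0 / X 1 0, ?_⟩
      apply m2_ext <;> simp [hq, hr] <;> grind
  · refine ⟨Y 0 0 - Y 0 1 / X 0 1 * X 0 0, Y 0 1 / X 0 1, ?_⟩
    apply m2_ext <;> simp [hq] <;> grind

lemma comm_trans {X Y Z : M2 F} (hX : ∀ a : F, X ≠ a • (1 : M2 F)) (h : Y * X = X * Y)
    (h' : Z * X = X * Z) : Y * Z = Z * Y := by
  obtain ⟨a, b, rfl⟩ := comm_comb hX h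
  simp [add_mul, mul_add, h']

/-- traceless part -/
def tl (x : SL2 F) : M2 F := (2 : F) • x.1 - x.1.trace • (1 : M2 F)

lemma tl_trace (x : SL2 F) : (tl x).trace = 0 := by
  simp [tl, Matrix.trace_fin_two]; ring

lemma tl_sq (x : SL2 F) : tl x * tl x = (x.1.trace ^ 2 - 4) • (1 : M2 F) := by
  have := sl_det x
  apply m2_ext <;> simp [tl, mul_ap, Matrix.trace_fin_two] <;> grind

lemma tl_ne (h2 : (2 : F) ≠ 0) {x : SL2 F} (hx : NC x) : tl x ≠ 0 := by
  intro h
  refine nc_of_nonscalar.1 hx (x.1.trace / 2) ?_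
  rw [tl, sub_eq_zero] at h
  rw [div_eq_inv_mul, mul_smul, ← h, smul_smul, inv_mul_cancel₀ h2, one_smul]

/-- Matrix commuting or anticommuting with `Z`. -/
def CA (h Z : M2 F) : Prop := h * Z = Z * h ∨ h * Z = -(Z * h)

lemma tl_comm_iff (h2 : (2 : F) ≠ 0) (x y : SL2 F) : y.1 * tl x = tl x * y.1 ↔ y * x = x * y := by
  have : y.1 * tl x - tl x * y.1 = (2 : F) • (y.1 * x.1 - x.1 * y.1) := by
    simp [tl, mul_sub, sub_mul, smul_sub]
  rw [← sub_eq_zero, this, smul_eq_zero, sub_eq_zero]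
  simp only [h2, false_or]
  exact ⟨fun h => sl_ext h, fun h => congrArg Subtype.val h⟩

lemma trace_zero_of_anti {x : SL2 F} {Z : M2 F} (h2 : (2 : F) ≠ 0) (hZ : Z * Z = 1)
    (h : x.1 * Z = -(Z * x.1)) : x.1.trace = 0 := by
  have h1 : x.1 = -(Z * x.1 * Z) := by
    calc x.1 = x.1 * (Z * Z) := by rw [hZ, mul_one]
      _ = _ := by rw [← mul_assoc, h]; simp
  have h3 : x.1.trace = - x.1.trace := by
    conv_lhs => rw [h1]
    rw [Matrix.trace_neg, Matrix.trace_mul_comm, ← mul_assoc, hZ, one_mul]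
  have : (2 : F) * x.1.trace = 0 := by linear_combination h3
  rcases mul_eq_zero.1 this with h | h
  · exact absurd h h2
  · exact h

lemma Z_nonscalar {Z : M2 F} (h2 : (2 : F) ≠ 0) (hZ : Z ≠ 0) (ht : Z.trace = 0) (a : F) :
    Z ≠ a • (1 : M2 F) := by
  rintro rfl
  simp at ht
  apply hZ
  rcases ht with h | h
  · simp [h]
  · exact absurd h h2

/-- A traceless matrix commuting with a noncentral `x` is a multiple of `tl x`. -/
lemma Z_eq_smul_tl (h2 : (2 : F) ≠ 0) {x : SL2 F} (hx : NC x) {Z : M2 F} (ht : Z.trace = 0)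
    (h : x.1 * Z = Z * x.1) : ∃ k : F, Z = k • tl x := by
  obtain ⟨a, b, rfl⟩ := comm_comb (nc_of_nonscalar.1 hx) h.symm
  refine ⟨b / 2, ?_⟩
  simp [Matrix.trace_fin_two] at ht
  have ha : a = - b / 2 * (x.1 0 0 + x.1 1 1) := by
    field_simp; linear_combination ht
  rw [ha]
  apply m2_ext <;> simp [tl, Matrix.trace_fin_two] <;> grind

/-- The subgroup of elements commuting or anticommuting with `Z`. -/
def NZ (Z : M2 F) : Subgroup (SL2 F) where
  carrier := {h | CA h.1 Z}
  one_mem' := Or.inl (by simp)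
  mul_mem' := by
    rintro a b (ha | ha) (hb | hb)
    · left; rw [mul_val, mul_assoc, hb, ← mul_assoc, ha, mul_assoc]
    · right; rw [mul_val, mul_assoc, hb, mul_neg, ← mul_assoc, ha, mul_assoc]
    · right; rw [mul_val, mul_assoc, hb, ← mul_assoc, ha, neg_mul, mul_assoc]
    · left; rw [mul_val, mul_assoc, hb, mul_neg, ← mul_assoc, ha, neg_mul, neg_neg, mul_assoc]
  inv_mem' := by
    intro a ha
    have e1 : (a⁻¹).1 * a.1 = 1 := by rw [← mul_val, inv_mul_cancel]; rfl
    have e2 : a.1 * (a⁻¹).1 = 1 := by rw [← mul_val, mul_inv_cancel]; rfl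
    rcases ha with ha | ha
    · left
      calc (a⁻¹).1 * Z = (a⁻¹).1 * (Z * a.1) * (a⁻¹).1 := by rw [mul_assoc, mul_assoc, e2, mul_one]
        _ = _ := by rw [← ha, ← mul_assoc, e1, one_mul]
    · right
      calc (a⁻¹).1 * Z = (a⁻¹).1 * (Z * a.1) * (a⁻¹).1 := by rw [mul_assoc, mul_assoc, e2, mul_one]
        _ = _ := by rw [← neg_eq_iff_eq_neg.2 ha, mul_neg, ← mul_assoc, e1]; simp

lemma mem_NZ {Z : M2 F} {h : SL2 F} : h ∈ NZ Z ↔ CA h.1 Z := Iff.rfl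

lemma NZ_ne_top (h2 : (2 : F) ≠ 0) {Z : M2 F} (hZ : Z ≠ 0) (ht : Z.trace = 0) : NZ Z ≠ ⊤ := by
  intro htop
  have h1 : mk 1 1 0 1 (by simp) ∈ NZ Z := by rw [htop]; trivial
  have h3 : mk 1 0 1 1 (by simp) ∈ NZ Z := by rw [htop]; trivial
  rw [mem_NZ, CA] at h1 h3
  simp only [m2_ext_iff, mul_ap, Matrix.neg_apply] at h1 h3
  simp [Matrix.trace_fin_two] at h1 h3 ht
  apply hZ
  have h4 : (2 : F) * 2 ≠ 0 := mul_ne_zero h2 h2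
  have e : Z 1 1 = - Z 0 0 := by linear_combination ht
  have k0 : Z 0 1 = 0 ∧ Z 1 0 = 0 ∧ Z 0 0 = 0 := by grind
  apply m2_ext <;> simp [k0, e]

end generic
end PSLsol


namespace PSLsol

lemma arith_sorted {h m0 m1 m2 n0 n1 n2 : ℕ} (hh : 0 < h) (e0 : m0 * n0 = h) (e1 : m1 * n1 = h)
    (e2 : m2 * n2 = h) (l0 : 2 ≤ n0) (l01 : n0 ≤ n1) (l12 : n1 ≤ n2) (hs : m0 + m1 + m2 = h + 2) :
    m2 = 2 ∨ ((h = 12 ∨ h = 24) ∧ (n0 = 2 ∧ n1 = 3 ∧ (n2 = 3 ∨ n2 = 4))) ∨ 5 ∣ h := by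
  have a0 : n0 < 3 := by
    by_contra hc
    have : m0 * 3 ≤ h := by rw [← e0]; exact Nat.mul_le_mul_left _ (by omega)
    have : m1 * 3 ≤ h := by rw [← e1]; exact Nat.mul_le_mul_left _ (by omega)
    have : m2 * 3 ≤ h := by rw [← e2]; exact Nat.mul_le_mul_left _ (by omega)
    omega
  obtain rfl : n0 = 2 := by omega
  have a1 : n1 < 4 := by
    by_contra hc
    have : m1 * 4 ≤ h := by rw [← e1]; exact Nat.mul_le_mul_left _ (by omega)
    have : m2 * 4 ≤ h := by rw [← e2]; exact Nat.mul_le_mul_left _ (by omega)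
    omega
  have : n1 = 2 ∨ n1 = 3 := by omega
  rcases this with rfl | rfl
  · left; omega
  · right
    have a2 : n2 < 6 := by
      by_contra hc
      have : m2 * 6 ≤ h := by rw [← e2]; exact Nat.mul_le_mul_left _ (by omega)
      omega
    have : n2 = 3 ∨ n2 = 4 ∨ n2 = 5 := by omega
    rcases this with rfl | rfl | rfl
    · left; omega
    · left; omega
    · right; omega

lemma arith_three {h m0 m1 m2 n0 n1 n2 : ℕ} (hh : 0 < h) (e0 : m0 * n0 = h) (e1 : m1 * n1 = h)
    (e2 : m2 * n2 = h) (l0 : 2 ≤ n0) (l1 : 2 ≤ n1) (l2 : 2 ≤ n2) (hs : m0 + m1 + m2 = h + 2) :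
    (m0 = 2 ∨ m1 = 2 ∨ m2 = 2) ∨ ((h = 12 ∨ h = 24) ∧
      ((n0 = 2 ∨ n0 = 3 ∨ n0 = 4) ∧ (n1 = 2 ∨ n1 = 3 ∨ n1 = 4) ∧ (n2 = 2 ∨ n2 = 3 ∨ n2 = 4))) ∨
      5 ∣ h := by
  rcases le_total n0 n1 with h01 | h01 <;> rcases le_total n1 n2 with h12 | h12 <;>
    rcases le_total n0 n2 with h02 | h02
  · have := arith_sorted hh e0 e1 e2 l0 h01 h12 hs; omega
  · have := arith_sorted hh e0 e1 e2 l0 h01 h12 hs; omega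
  · have := arith_sorted hh e0 e2 e1 l0 h02 h12 (by omega); omega
  · have := arith_sorted hh e2 e0 e1 l2 h02 h01 (by omega); omega
  · have := arith_sorted hh e1 e0 e2 l1 h01 h02 (by omega); omega
  · have := arith_sorted hh e1 e2 e0 l1 h12 h02 (by omega); omega
  · have := arith_sorted hh e2 e1 e0 l2 h12 h01 (by omega); omega
  · have := arith_sorted hh e2 e1 e0 l2 h12 h01 (by omega); omega

open MulAction in
lemma action_count {H X : Type*} [Group H] [Finite H] [Finite X] [MulAction H X] (c : H)
    (hc1 : c ≠ 1) (hcc : c * c = 1) (hc : ∀ x : X, c • x = x)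
    (hfix : ∀ g : H, g ≠ 1 → g ≠ c → Nat.card (fixedBy X g) = 2)
    (hst : ∀ x : X, ∃ g : H, g ≠ 1 ∧ g ≠ c ∧ g • x = x) :
    Nat.card H = 2 ∨ Nat.card X = 2 ∨ (∃ x : X, (stabilizer H x).index = 2) ∨
    ((Nat.card H = 24 ∨ Nat.card H = 48) ∧ ∀ x : X, Nat.card (stabilizer H x) = 4 ∨
      Nat.card (stabilizer H x) = 6 ∨ Nat.card (stabilizer H x) = 8) ∨ 5 ∣ Nat.card H := by
  classical
  have := Fintype.ofFinite H
  have := Fintype.ofFinite X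
  -- stabilizers
  have hord : orderOf c = 2 := orderOf_eq_prime (by rw [pow_two, hcc]) hc1
  obtain ⟨h, hh⟩ : 2 ∣ Nat.card H := by rw [← hord]; exact orderOf_dvd_natCard c
  have hHpos : 0 < Nat.card H := Nat.card_pos
  have hstab : ∀ x : X, ∃ n, 2 ≤ n ∧ Nat.card (stabilizer H x) = 2 * n := by
    intro x
    obtain ⟨n, hn⟩ : 2 ∣ Nat.card (stabilizer H x) := by
      rw [← hord, ← Subgroup.orderOf_mk c (show c ∈ stabilizer H x from hc x)]
      exact orderOf_dvd_natCard _
    refine ⟨n, ?_, hn⟩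
    obtain ⟨g, g1, gc, gx⟩ := hst x
    have h3 : 3 ≤ Nat.card (stabilizer H x) := by
      have hsub : (({1, c, g} : Finset H) : Set H) ⊆ (stabilizer H x : Set H) := by
        intro z hz
        simp at hz
        rcases hz with rfl | rfl | rfl
        · exact one_mem _
        · exact hc x
        · exact gx
      have hcard : ({1, c, g} : Finset H).card = 3 := by
        rw [Finset.card_eq_three]; exact ⟨1, c, g, hc1.symm, g1.symm, gc.symm, rfl⟩
      have := Set.ncard_le_ncard hsub (Set.toFinite _)
      rw [Set.ncard_coe_finset, hcard] at this
      exact this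
    omega
  -- Burnside
  have hB := sum_card_fixedBy_eq_card_orbits_mul_card_group H X
  have hsum : (∑ g : H, Fintype.card (fixedBy X g)) + 4 = 2 * Nat.card H + 2 * Nat.card X := by
    have e : ∀ g : H, Fintype.card (fixedBy X g) + (if g = 1 then 2 else 0) +
        (if g = c then 2 else 0) = 2 + (if g = 1 then Nat.card X else 0) +
        (if g = c then Nat.card X else 0) := by
      intro g
      by_cases h1 : g = 1
      · subst h1
        simp [hc1.symm]
        omega
      · by_cases h2 : g = c
        · subst h2
          have : fixedBy X g = Set.univ := by ext x; simp [mem_fixedBy, hc x]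
          rw [if_neg h1, if_neg h1, if_pos rfl, if_pos rfl]
          rw [Fintype.card_congr (Equiv.setCongr this), Fintype.card_congr (Equiv.Set.univ X),
            Nat.card_eq_fintype_card]
          omega
        · rw [if_neg h1, if_neg h1, if_neg h2, if_neg h2]
          have := hfix g h1 h2
          rw [Nat.card_eq_fintype_card] at this
          omega
    have e2 := Finset.sum_congr (rfl : (Finset.univ : Finset H) = Finset.univ) (fun g _ => e g)
    simp only [Finset.sum_add_distrib, Finset.sum_ite_eq', Finset.mem_univ, if_true] at e2
    simp only [Finset.sum_const, Finset.card_univ, smul_eq_mul] at e2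
    rw [Nat.card_eq_fintype_card (α := H)]
    omega
  have hC := card_eq_sum_card_group_div_card_stabilizer H X
  set Ω := Quotient (orbitRel H X) with hΩ
  have hm : ∀ x : X, ∃ m n, 2 ≤ n ∧ Nat.card (stabilizer H x) = 2 * n ∧
      Fintype.card H / Fintype.card (stabilizer H x) = m ∧ m * n = h ∧
      (stabilizer H x).index = m := by
    intro x
    obtain ⟨n, hn, e⟩ := hstab x
    have h3 := (stabilizer H x).card_mul_index
    refine ⟨(stabilizer H x).index, n, hn, e, ?_, ?_, rfl⟩
    · rw [← Nat.card_eq_fintype_card, ← Nat.card_eq_fintype_card, ← h3]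
      exact Nat.mul_div_cancel_left _ (by omega)
    · rw [e, hh] at h3
      have : 2 * ((stabilizer H x).index * n) = 2 * h := by rw [← h3]; ring
      omega
  have hle : 2 * Nat.card X ≤ Fintype.card Ω * h := by
    rw [Nat.card_eq_fintype_card, hC, Finset.mul_sum]
    calc _ ≤ ∑ ω : Ω, h := by
          apply Finset.sum_le_sum
          intro ω _
          obtain ⟨m, n, hn, -, e, e', -⟩ := hm ω.out
          rw [e, ← e', mul_comm]
          exact Nat.mul_le_mul_left _ hn
      _ = _ := by simp
  rw [← Nat.card_eq_fintype_card (α := H)] at hB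
  have hB' : (∑ g : H, Fintype.card (fixedBy X g)) = Fintype.card Ω * Nat.card H := hB
  rw [hB', hh] at hsum
  rw [hh] at hHpos
  have hr : Fintype.card Ω < 4 := by
    by_contra hcon
    have : 4 * h ≤ Fintype.card Ω * h := Nat.mul_le_mul_right _ (by omega)
    have e : Fintype.card Ω * (2 * h) = 2 * (Fintype.card Ω * h) := by ring
    omega
  have : Fintype.card Ω = 0 ∨ Fintype.card Ω = 1 ∨ Fintype.card Ω = 2 ∨ Fintype.card Ω = 3 := by
    omega
  rcases this with h0 | h0 | h0 | h0
  · left; rw [h0] at hsum; omega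
  · left; rw [h0] at hsum
    have : 0 < Nat.card X := by
      have : Nonempty Ω := Fintype.card_pos_iff.1 (by omega)
      obtain ⟨ω⟩ := this
      have : Nonempty X := ⟨ω.out⟩
      exact Nat.card_pos
    omega
  · right; left; rw [h0] at hsum; omega
  · right; right
    rw [h0] at hsum
    let e := Fintype.equivFinOfCardEq h0
    rw [← Nat.card_eq_fintype_card, ← Equiv.sum_comp e.symm, Fin.sum_univ_three] at hC
    have hm' := fun i : Fin 3 => hm (e.symm i).out
    choose m n hn hcard hdiv hmn hind using hm'
    rw [hdiv, hdiv, hdiv] at hC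
    have h3 := arith_three (by omega) (hmn 0) (hmn 1) (hmn 2) (hn 0) (hn 1) (hn 2) (by omega)
    rcases h3 with h3 | ⟨h3, h4⟩ | h3
    · left
      rcases h3 with h3 | h3 | h3
      · exact ⟨_, (hind 0).trans h3⟩
      · exact ⟨_, (hind 1).trans h3⟩
      · exact ⟨_, (hind 2).trans h3⟩
    · right; left
      refine ⟨by omega, fun x => ?_⟩
      have hx : ∃ i : Fin 3, Nat.card (stabilizer H x) = Nat.card (stabilizer H (e.symm i).out) := by
        refine ⟨e (Quotient.mk'' x), ?_⟩
        rw [Equiv.symm_apply_apply]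
        have : (orbitRel H X) (Quotient.mk'' x : Ω).out x := Quotient.mk_out x
        exact (Nat.card_congr (stabilizerEquivStabilizerOfOrbitRel this).toEquiv).symm
      obtain ⟨i, hi⟩ := hx
      rw [hi, hcard i]
      fin_cases i <;> simp <;> omega
    · right; right
      rw [hh]; exact Dvd.dvd.mul_left h3 2

end PSLsol


namespace PSLsol
open Matrix

section count
variable {K : Type*} [Field K]

lemma inv_mul_val (x : SL2 K) : (x⁻¹).1 * x.1 = 1 := by rw [← mul_val, inv_mul_cancel]; rfl
lemma mul_inv_val (x : SL2 K) : x.1 * (x⁻¹).1 = 1 := by rw [← mul_val, mul_inv_cancel]; rfl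

lemma conj_eq_iff (h : SL2 K) (Z W : M2 K) : h.1 * Z * (h⁻¹).1 = W ↔ h.1 * Z = W * h.1 := by
  constructor
  · rintro rfl
    rw [mul_assoc, inv_mul_val, mul_one]
  · intro e
    rw [e, mul_assoc, mul_inv_val, mul_one]

lemma fix_pair [IsAlgClosed K] (h2 : (2 : K) ≠ 0) {h : SL2 K} (hn : NC h) (ht : h.1.trace ^ 2 ≠ 4) :
    ∃ Z0 : M2 K, Z0 * Z0 = 1 ∧ Z0.trace = 0 ∧ h.1 * Z0 = Z0 * h.1 ∧
      ∀ Z : M2 K, Z * Z = 1 → Z.trace = 0 → h.1 * Z = Z * h.1 → Z = Z0 ∨ Z = -Z0 := by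
  obtain ⟨d, hd⟩ := IsAlgClosed.exists_pow_nat_eq (h.1.trace ^ 2 - 4) (n := 2) (by norm_num)
  have hd0 : d ≠ 0 := by
    rintro rfl
    apply ht
    linear_combination -hd
  refine ⟨d⁻¹ • tl h, ?_, ?_, ?_, ?_⟩
  · rw [Matrix.smul_mul, Matrix.mul_smul, tl_sq, ← hd, smul_smul, smul_smul]
    have : d⁻¹ * d⁻¹ * d ^ 2 = 1 := by field_simp
    rw [this, one_smul]
  · rw [Matrix.trace_smul, tl_trace, smul_zero]
  · rw [Matrix.mul_smul, Matrix.smul_mul, (tl_comm_iff h2 h h).2 rfl]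
  · intro Z hZ hZt hc
    obtain ⟨k, rfl⟩ := Z_eq_smul_tl h2 hn hZt hc
    rw [Matrix.smul_mul, Matrix.mul_smul, tl_sq, ← hd, smul_smul, smul_smul] at hZ
    have h00 := congrFun (congrFun hZ 0) 0
    simp at h00
    have : (k * d - 1) * (k * d + 1) = 0 := by linear_combination h00
    rcases mul_eq_zero.1 this with e | e
    · left
      congr 1
      field_simp
      linear_combination e
    · right
      rw [← neg_smul]
      congr 1
      field_simp
      linear_combination e

/-- The set of normalized axes. -/
def XS (H : Subgroup (SL2 K)) : Set (M2 K) :=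
  {Z | Z * Z = 1 ∧ Z.trace = 0 ∧ ∃ h ∈ H, NC h ∧ h.1 * Z = Z * h.1}

lemma NC_conj {h g : SL2 K} (hn : NC h) : NC (g * h * g⁻¹) := by
  constructor
  · intro e
    apply hn.1
    have : h = g⁻¹ * (g * h * g⁻¹) * g := by group
    rw [this, e]; simp
  · intro e
    apply hn.2
    have : h = g⁻¹ * (g * h * g⁻¹) * g := by group
    rw [this, e]; simp

lemma conj_prod (g : SL2 K) (A B : M2 K) :
    (g.1 * A * (g⁻¹).1) * (g.1 * B * (g⁻¹).1) = g.1 * (A * B) * (g⁻¹).1 := by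
  have : (g.1 * A * (g⁻¹).1) * (g.1 * B * (g⁻¹).1) = g.1 * A * ((g⁻¹).1 * g.1) * B * (g⁻¹).1 := by
    simp only [mul_assoc]
  rw [this, inv_mul_val]
  simp only [mul_assoc, one_mul]

instance actXS (H : Subgroup (SL2 K)) : MulAction H (XS H) where
  smul g Z := ⟨g.1.1 * Z.1 * (g.1⁻¹).1, by
    obtain ⟨Z, h1, h2, h, hh, hn, hc⟩ := Z
    refine ⟨?_, ?_, g.1 * h * g.1⁻¹, ?_, NC_conj hn, ?_⟩
    · rw [conj_prod, h1, mul_one, mul_inv_val]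
    · rw [Matrix.trace_mul_comm, ← mul_assoc, inv_mul_val, one_mul, h2]
    · exact H.mul_mem (H.mul_mem g.2 hh) (H.inv_mem g.2)
    · rw [mul_val, mul_val, conj_prod, conj_prod]; exact congrArg (fun W => g.1.1 * W * (g.1⁻¹).1) hc⟩
  one_smul Z := by
    apply Subtype.ext
    show (1 : SL2 K).1 * Z.1 * ((1 : SL2 K)⁻¹).1 = Z.1
    simp
  mul_smul g h Z := by
    apply Subtype.ext
    show (g.1 * h.1).1 * Z.1 * ((g.1 * h.1)⁻¹).1 = g.1.1 * (h.1.1 * Z.1 * (h.1⁻¹).1) * (g.1⁻¹).1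
    rw [_root_.mul_inv_rev, mul_val, mul_val]
    simp only [mul_assoc]

lemma smul_XS (H : Subgroup (SL2 K)) (g : H) (Z : XS H) :
    (g • Z).1 = g.1.1 * Z.1 * (g.1⁻¹).1 := rfl

lemma smul_XS_iff (H : Subgroup (SL2 K)) (g : H) (Z W : XS H) :
    g • Z = W ↔ g.1.1 * Z.1 = W.1 * g.1.1 := by
  rw [← conj_eq_iff, ← smul_XS, Subtype.ext_iff]

lemma exists_Z0 : ∃ Z : M2 K, Z * Z = 1 ∧ Z.trace = 0 := by
  refine ⟨!![1, 0; 0, -1], ?_, ?_⟩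
  · apply m2_ext <;> simp [mul_ap]
  · simp [Matrix.trace_fin_two]

lemma ne_zero_of_sq {Z : M2 K} (h : Z * Z = 1) : Z ≠ 0 := by
  rintro rfl
  simp at h

lemma count_XS [IsAlgClosed K] (h2 : (2 : K) ≠ 0) (H : Subgroup (SL2 K)) [Finite H]
    (hneg : -1 ∈ H) (hss : ∀ h ∈ H, h.1.trace ^ 2 = 4 → h = 1 ∨ h = -1) :
    (∃ Z : M2 K, Z * Z = 1 ∧ Z.trace = 0 ∧ ∀ h ∈ H, CA h.1 Z) ∨
    ((Nat.card H = 24 ∨ Nat.card H = 48) ∧ ∀ h ∈ H, NC h → h ^ 4 = 1 ∨ h ^ 6 = 1 ∨ h ^ 8 = 1) ∨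
    5 ∣ Nat.card H := by
  classical
  have htr : ∀ h ∈ H, NC h → h.1.trace ^ 2 ≠ 4 := by
    intro h hh hn e
    rcases hss h hh e with r | r
    · exact hn.1 r
    · exact hn.2 r
  have hone : (1 : SL2 K) ≠ -1 := by
    intro e
    have := congrArg (fun g : SL2 K => g.1 0 0) e
    simp [one00] at this
    apply h2
    linear_combination this
  have hfin : (XS H).Finite := by
    have : XS H ⊆ ⋃ h : H, {Z : M2 K | Z * Z = 1 ∧ Z.trace = 0 ∧ NC h.1 ∧ h.1.1 * Z = Z * h.1.1} := by
      rintro Z ⟨a, b, h, hh, hn, hc⟩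
      exact Set.mem_iUnion.2 ⟨⟨h, hh⟩, a, b, hn, hc⟩
    refine Set.Finite.subset (Set.finite_iUnion fun h => ?_) this
    by_cases hn : NC h.1
    · obtain ⟨Z0, -, -, -, hu⟩ := fix_pair h2 hn (htr _ h.2 hn)
      refine Set.Finite.subset (Set.toFinite ({Z0, -Z0} : Set (M2 K))) ?_
      rintro Z ⟨a, b, -, c⟩
      exact hu Z a b c
    · refine Set.Finite.subset Set.finite_empty ?_
      rintro Z ⟨a, b, c, -⟩
      exact hn c
  have : Finite (XS H) := hfin
  let c : H := ⟨-1, hneg⟩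
  have hNC : ∀ g : H, g ≠ 1 → g ≠ c → NC g.1 := fun g g1 gc =>
    ⟨fun e => g1 (Subtype.ext e), fun e => gc (Subtype.ext e)⟩
  have hNC' : ∀ g : H, NC g.1 → g ≠ 1 ∧ g ≠ c := fun g hn =>
    ⟨fun e => hn.1 (congrArg Subtype.val e), fun e => hn.2 (congrArg Subtype.val e)⟩
  have key := action_count (H := H) (X := XS H) c
    (fun e => hone (congrArg Subtype.val e).symm) (Subtype.ext (by simp [c]))
    (fun Z => by rw [smul_XS_iff]; simp [c])
    (by
      intro g g1 gc
      have hn := hNC g g1 gc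
      obtain ⟨Z0, h1, h3, h4, hu⟩ := fix_pair h2 hn (htr _ g.2 hn)
      have hm : Z0 ∈ XS H := ⟨h1, h3, g.1, g.2, hn, h4⟩
      have hm' : -Z0 ∈ XS H := ⟨by simpa using h1, by simpa using h3, g.1, g.2, hn, by simpa using h4⟩
      have e : MulAction.fixedBy (XS H) g = {⟨Z0, hm⟩, ⟨-Z0, hm'⟩} := by
        ext Z
        rw [MulAction.mem_fixedBy, smul_XS_iff]
        constructor
        · intro e
          rcases hu Z.1 Z.2.1 Z.2.2.1 e with r | r
          · left; exact Subtype.ext r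
          · right; exact Subtype.ext r
        · rintro (r | r)
          · rw [r]; exact h4
          · rw [r]; simpa using h4
      rw [e]
      show Set.ncard _ = 2
      rw [Set.ncard_pair]
      intro e
      have e' : Z0 = -Z0 := congrArg Subtype.val e
      have : (2 : K) • Z0 = 0 := by rw [two_smul]; nth_rw 1 [e']; simp
      rcases smul_eq_zero.1 this with r | r
      · exact h2 r
      · exact ne_zero_of_sq h1 r)
    (by
      rintro ⟨Z, a, b, h, hh, hn, hc⟩
      refine ⟨⟨h, hh⟩, (hNC' ⟨h, hh⟩ hn).1, (hNC' ⟨h, hh⟩ hn).2, ?_⟩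
      rw [smul_XS_iff]; exact hc)
  rcases key with hk | hk | ⟨Z, hk⟩ | ⟨hk, hk'⟩ | hk
  · left
    obtain ⟨Z, hZ, ht⟩ := exists_Z0 (K := K)
    refine ⟨Z, hZ, ht, fun h hh => ?_⟩
    by_contra hcon
    have hn : NC h := by
      constructor
      · rintro rfl; exact hcon (Or.inl (by simp))
      · rintro rfl; exact hcon (Or.inl (by simp))
    have hsub : (({1, c, ⟨h, hh⟩} : Finset H) : Set H) ⊆ Set.univ := Set.subset_univ _
    have hcard : ({1, c, ⟨h, hh⟩} : Finset H).card = 3 := by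
      rw [Finset.card_eq_three]
      exact ⟨1, c, ⟨h, hh⟩, fun e => hone (congrArg Subtype.val e), (hNC' _ hn).1.symm,
        (hNC' _ hn).2.symm, rfl⟩
    have := Set.ncard_le_ncard hsub (Set.toFinite _)
    rw [Set.ncard_coe_finset, hcard, Set.ncard_univ] at this
    omega
  · left
    have hne : Nonempty (XS H) := by
      by_contra hcon
      rw [not_nonempty_iff] at hcon
      rw [Nat.card_of_isEmpty] at hk
      omega
    obtain ⟨Z⟩ := hne
    have hm' : -Z.1 ∈ XS H := by
      obtain ⟨Z, a, b, h, hh, hn, hc⟩ := Z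
      exact ⟨by simpa using a, by simpa using b, h, hh, hn, by simpa using hc⟩
    have hZ0 := ne_zero_of_sq Z.2.1
    have hne : Z ≠ ⟨-Z.1, hm'⟩ := by
      intro e
      have e' : Z.1 = -Z.1 := congrArg Subtype.val e
      have : (2 : K) • Z.1 = 0 := by rw [two_smul]; nth_rw 1 [e']; simp
      rcases smul_eq_zero.1 this with r | r
      · exact h2 r
      · exact hZ0 r
    have hall : ∀ W : XS H, W = Z ∨ W = ⟨-Z.1, hm'⟩ := by
      intro W
      have huniv : ({Z, ⟨-Z.1, hm'⟩} : Set (XS H)) = Set.univ := by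
        apply Set.eq_of_subset_of_ncard_le (Set.subset_univ _)
        rw [Set.ncard_univ, hk, Set.ncard_pair hne]
      have : W ∈ ({Z, ⟨-Z.1, hm'⟩} : Set (XS H)) := by rw [huniv]; trivial
      exact this
    refine ⟨Z.1, Z.2.1, Z.2.2.1, fun h hh => ?_⟩
    rcases hall ((⟨h, hh⟩ : H) • Z) with e | e
    · left; exact (smul_XS_iff H ⟨h, hh⟩ Z _).1 e
    · right
      have := (smul_XS_iff H ⟨h, hh⟩ Z _).1 e
      simpa using this
  · left
    have hnorm := Subgroup.normal_of_index_eq_two hk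
    refine ⟨Z.1, Z.2.1, Z.2.2.1, fun h hh => ?_⟩
    obtain ⟨k, hkH, hkn, hkc⟩ := Z.2.2.2
    have hks : (⟨k, hkH⟩ : H) ∈ MulAction.stabilizer H Z := (smul_XS_iff H ⟨k, hkH⟩ Z Z).2 hkc
    have h1 := hnorm.conj_mem _ hks (⟨h, hh⟩ : H)⁻¹
    rw [MulAction.mem_stabilizer_iff, mul_smul, mul_smul, inv_smul_eq_iff, inv_inv] at h1
    have h3 := (smul_XS_iff H ⟨k, hkH⟩ _ _).1 h1
    obtain ⟨Z0, -, -, -, hu⟩ := fix_pair h2 hkn (htr k hkH hkn)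
    have hW := ((⟨h, hh⟩ : H) • Z).2
    have e1 := hu _ Z.2.1 Z.2.2.1 hkc
    have e2 := hu _ hW.1 hW.2.1 h3
    rw [CA, ← conj_eq_iff h Z.1 Z.1, ← neg_mul, ← conj_eq_iff h Z.1 (-Z.1)]
    rw [smul_XS] at e2
    rcases e1 with e1 | e1 <;> rcases e2 with e2 | e2
    · left; rw [e2]; exact e1.symm
    · right; rw [e2, e1]
    · right; rw [e2, e1, neg_neg]
    · left; rw [e2]; exact e1.symm
  · right; left
    refine ⟨hk, fun h hh hn => ?_⟩
    obtain ⟨Z0, h1, h3, h4, hu⟩ := fix_pair h2 hn (htr _ hh hn)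
    have hm : Z0 ∈ XS H := ⟨h1, h3, h, hh, hn, h4⟩
    have hs : (⟨h, hh⟩ : H) ∈ MulAction.stabilizer H (⟨Z0, hm⟩ : XS H) :=
      (smul_XS_iff H ⟨h, hh⟩ _ _).2 h4
    have hp : ∀ n, Nat.card (MulAction.stabilizer H (⟨Z0, hm⟩ : XS H)) = n → h ^ n = 1 := by
      rintro n rfl
      have := pow_card_eq_one' (x := (⟨⟨h, hh⟩, hs⟩ : MulAction.stabilizer H (⟨Z0, hm⟩ : XS H)))
      exact congrArg (fun g => g.1.1) this
    rcases hk' ⟨Z0, hm⟩ with e | e | e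
    · left; exact hp _ e
    · right; left; exact hp _ e
    · right; right; exact hp _ e
  · right; right; exact hk

/-- elements whose square is one. -/
lemma sq_one (h2 : (2 : K) ≠ 0) {h : SL2 K} (e : h * h = 1) : h = 1 ∨ h = -1 := by
  by_contra hcon
  push Not at hcon
  have hn := nc_of_nonscalar.1 hcon
  have e1 : h.1 * h.1 = 1 := by rw [← mul_val, e]; rfl
  rw [sl_sq] at e1
  by_cases ht : h.1.trace = 0
  · rw [ht] at e1
    have := congrFun (congrFun e1 0) 0
    simp at this
    apply h2; linear_combination -this
  · apply hn (2 / h.1.trace)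
    rw [m2_ext_iff] at e1 ⊢
    simp at e1 ⊢
    field_simp
    grind

lemma sq_neg_one {h : SL2 K} (hn : NC h) (e : h * h = -1) : h.1.trace = 0 := by
  have e1 : h.1 * h.1 = -1 := by rw [← mul_val, e]; simp
  rw [sl_sq] at e1
  by_contra ht
  apply nc_of_nonscalar.1 hn 0
  rw [m2_ext_iff] at e1 ⊢
  simp at e1 ⊢
  grind

lemma trace_of_pow (h2 : (2 : K) ≠ 0) {h : SL2 K} (hn : NC h)
    (hp : h ^ 4 = 1 ∨ h ^ 6 = 1 ∨ h ^ 8 = 1) :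
    h.1.trace ^ 2 = 0 ∨ h.1.trace ^ 2 = 1 ∨ h.1.trace ^ 2 = 2 := by
  have h4 : ∀ h : SL2 K, NC h → h ^ 4 = 1 → h.1.trace = 0 := by
    intro h hn hp
    have : (h * h) * (h * h) = 1 := by rw [← hp]; simp [pow_succ, mul_assoc]
    rcases sq_one h2 this with e | e
    · rcases sq_one h2 e with r | r
      · exact absurd r hn.1
      · exact absurd r hn.2
    · exact sq_neg_one hn e
  rcases hp with hp | hp | hp
  · left; rw [h4 h hn hp]; ring
  · right; left
    have h3 : (h * h * h) * (h * h * h) = 1 := by rw [← hp]; simp [pow_succ, mul_assoc]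
    have e3 : (h * h * h).1 = (h.1.trace ^ 2 - 1) • h.1 - h.1.trace • (1 : M2 K) := by
      rw [mul_val, mul_val, sl_sq, sub_mul, smul_mul_assoc, sl_sq]
      apply m2_ext <;> simp <;> ring
    by_contra hcon
    have hcon' : h.1.trace ^ 2 - 1 ≠ 0 := fun e => hcon (by linear_combination e)
    have : ∃ a : K, (h * h * h).1 = a • (1 : M2 K) := by
      rcases sq_one h2 h3 with e | e
      · exact ⟨1, by rw [e]; simp⟩
      · exact ⟨-1, by rw [e]; simp⟩
    obtain ⟨a, ha⟩ := this
    rw [e3] at ha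
    apply nc_of_nonscalar.1 hn ((a + h.1.trace) / (h.1.trace ^ 2 - 1))
    rw [m2_ext_iff] at ha ⊢
    simp at ha ⊢
    field_simp
    grind
  · by_cases hn2 : NC (h * h)
    · right; right
      have e : (h * h) ^ 4 = 1 := by rw [← hp]; simp [pow_succ, mul_assoc]
      have := h4 _ hn2 e
      rw [mul_val, sl_sq, Matrix.trace_sub, Matrix.trace_smul, Matrix.trace_one] at this
      simp at this
      linear_combination this
    · left
      have : h * h = 1 ∨ h * h = -1 := by
        unfold NC at hn2; tauto
      rcases this with e | e
      · rcases sq_one h2 e with r | r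
        · exact absurd r hn.1
        · exact absurd r hn.2
      · rw [sq_neg_one hn e]; ring

end count
end PSLsol


namespace PSLsol
open Matrix

lemma solv_of_comm_sub {G : Type*} [Group G] (C : Subgroup G) (h1 : ∀ a b : G, a * b * a⁻¹ * b⁻¹ ∈ C)
    (h2 : ∀ a ∈ C, ∀ b ∈ C, a * b = b * a) : Group.IsSolvable G := by
  refine ⟨⟨2, ?_⟩⟩
  have e1 : derivedSeries G 1 ≤ C := by
    rw [derivedSeries_one, commutator_def, Subgroup.commutator_le]
    intro a _ b _
    exact h1 a b
  rw [derivedSeries_succ, eq_bot_iff, Subgroup.commutator_le]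
  intro a ha b hb
  rw [Subgroup.mem_bot, commutatorElement_eq_one_iff_mul_comm]
  exact h2 a (e1 ha) b (e1 hb)

lemma solv_perm3 : Group.IsSolvable (Equiv.Perm (Fin 3)) := by
  apply solv_of_comm_sub (alternatingGroup (Fin 3))
  · intro a b
    rw [Equiv.Perm.mem_alternatingGroup]
    have : ∀ s t : ℤˣ, s * t * s⁻¹ * t⁻¹ = 1 := by decide
    simp only [map_mul, map_inv]
    exact this _ _
  · have : ∀ a b : Equiv.Perm (Fin 3), Equiv.Perm.sign a = 1 → Equiv.Perm.sign b = 1 →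
        a * b = b * a := by decide
    intro a ha b hb
    exact this a b ha hb

lemma solv_24_48 {G : Type*} [Group G] [Finite G] (h : Nat.card G = 24 ∨ Nat.card G = 48) :
    Group.IsSolvable G := by
  have : Fact (Nat.Prime 2) := ⟨Nat.prime_two⟩
  obtain ⟨P⟩ : Nonempty (Sylow 2 G) := inferInstance
  have hP := P.card_eq_multiplicity
  have hind : (P : Subgroup G).index = 3 := by
    have h3 := (P : Subgroup G).card_mul_index
    rw [hP] at h3
    have f24 : Nat.factorization 24 2 = 3 := by
      rw [show 24 = 2 ^ 3 * 3 by norm_num, Nat.factorization_mul (by norm_num) (by norm_num)]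
      rw [Nat.factorization_pow]
      simp [Nat.Prime.factorization Nat.prime_three, Nat.prime_two.factorization]
    have f48 : Nat.factorization 48 2 = 4 := by
      rw [show 48 = 2 ^ 4 * 3 by norm_num, Nat.factorization_mul (by norm_num) (by norm_num)]
      rw [Nat.factorization_pow]
      simp [Nat.Prime.factorization Nat.prime_three, Nat.prime_two.factorization]
    rcases h with h | h
    · rw [h, f24] at h3; omega
    · rw [h, f48] at h3; omega
  have hc : Nat.card (G ⧸ (P : Subgroup G)) = 3 := hind
  let e : (G ⧸ (P : Subgroup G)) ≃ Fin 3 := Finite.equivFinOfCardEq hc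
  have hs : Group.IsSolvable (Equiv.Perm (G ⧸ (P : Subgroup G))) := by
    have := solv_perm3
    exact Group.isSolvable_of_isSolvable_injective (f := (e.permCongrHom).toMonoidHom) e.permCongrHom.injective
  let f := MulAction.toPermHom G (G ⧸ (P : Subgroup G))
  have hk : Group.IsSolvable f.ker := by
    have hle : f.ker ≤ P := by
      rw [← Subgroup.normalCore_eq_ker]; exact Subgroup.normalCore_le _
    have hpg : IsPGroup 2 f.ker := P.isPGroup'.to_le hle
    have := hpg.isNilpotent
    infer_instance
  exact Group.isSolvable_of_ker_le_range f.ker.subtype f (by simp)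

section borel
variable {F : Type*} [Field F]

/-- upper triangular subgroup. -/
def UT : Subgroup (SL2 F) where
  carrier := {h | h.1 1 0 = 0}
  one_mem' := by simp
  mul_mem' := by
    intro a b ha hb
    simp only [Set.mem_ofPred_eq] at *
    rw [mul_val, mul_ap, ha, hb]; ring
  inv_mem' := by
    intro a ha
    simp only [Set.mem_ofPred_eq] at *
    rw [inv_val]; simp [ha]

lemma mem_UT {h : SL2 F} : h ∈ UT ↔ h.1 1 0 = 0 := Iff.rfl

lemma UT_solv : Group.IsSolvable (UT : Subgroup (SL2 F)) := by
  let C : Subgroup (UT : Subgroup (SL2 F)) :=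
    { carrier := {h | h.1.1 0 0 = 1 ∧ h.1.1 1 1 = 1}
      one_mem' := by simp
      mul_mem' := by
        rintro ⟨a, ha⟩ ⟨b, hb⟩ h1 h2
        simp only [Set.mem_ofPred_eq] at *
        rw [mem_UT] at ha hb
        simp [mul_ap, ha, hb, h1, h2]
      inv_mem' := by
        rintro ⟨a, ha⟩ h1
        simp only [Set.mem_ofPred_eq, mem_UT] at *
        have : ((⟨a, ha⟩ : (UT : Subgroup (SL2 F)))⁻¹).1 = a⁻¹ := rfl
        rw [this, inv_val]
        simp [h1] }
  apply solv_of_comm_sub C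
  · rintro ⟨a, ha⟩ ⟨b, hb⟩
    show (a * b * a⁻¹ * b⁻¹).1 0 0 = 1 ∧ (a * b * a⁻¹ * b⁻¹).1 1 1 = 1
    simp only [mem_UT] at ha hb
    have da := sl_det a
    have db := sl_det b
    rw [ha] at da
    rw [hb] at db
    constructor
    · rw [mul_val, mul_val, mul_val, inv_val, inv_val]
      simp [mul_ap, ha, hb]
      linear_combination (b.1 0 0 * b.1 1 1) * da + db
    · rw [mul_val, mul_val, mul_val, inv_val, inv_val]
      simp [mul_ap, ha, hb]
      linear_combination (b.1 0 0 * b.1 1 1) * da + db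
  · rintro ⟨a, ha⟩ h1 ⟨b, hb⟩ h2
    apply Subtype.ext
    apply sl_ext
    show a.1 * b.1 = b.1 * a.1
    change a.1 0 0 = 1 ∧ a.1 1 1 = 1 at h1
    change b.1 0 0 = 1 ∧ b.1 1 1 = 1 at h2
    simp only [mem_UT] at ha hb
    apply m2_ext <;> simp [mul_ap, ha, hb, h1, h2, add_comm]

def E12 (t : F) : SL2 F := mk 1 t 0 1 (by simp)
def E21 (t : F) : SL2 F := mk 1 0 t 1 (by simp)

lemma E12_mul (s t : F) : E12 s * E12 t = E12 (s + t) := by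
  apply sl_ext
  apply m2_ext <;> simp [E12, mul_ap, add_comm]

lemma E12_pow (s : F) (n : ℕ) : E12 s ^ n = E12 (n * s) := by
  induction n with
  | zero => apply sl_ext; apply m2_ext <;> simp [E12]
  | succ n ih => rw [pow_succ, ih, E12_mul]; congr 1; push_cast; ring

/-- A unipotent is conjugate to an elementary matrix. -/
lemma unip_conj {u : SL2 F} (ht : u.1.trace = 2) (hu : u ≠ 1) :
    ∃ (P : SL2 F) (l : F), l ≠ 0 ∧ u = P * E12 l * P⁻¹ := by
  have hd := sl_det u
  rw [Matrix.trace_fin_two] at ht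
  by_cases hc : u.1 1 0 = 0
  · have h0 : u.1 0 0 = 1 := by
      have : (u.1 0 0 - 1) ^ 2 = 0 := by grind
      have := pow_eq_zero_iff (two_ne_zero) |>.1 this
      linear_combination this
    have h1 : u.1 1 1 = 1 := by linear_combination ht - h0
    refine ⟨1, u.1 0 1, ?_, ?_⟩
    · intro h
      apply hu
      apply sl_ext
      apply m2_ext <;> simp [*]
    · apply sl_ext
      apply m2_ext <;> simp [*, E12]
  · refine ⟨mk (u.1 0 0 - 1) (-1 / u.1 1 0) (u.1 1 0) 0 (by field_simp; ring), -1 / u.1 1 0 * (-1) * (-1), ?_, ?_⟩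
    · simpa using hc
    · have h1 : u.1 1 1 = 2 - u.1 0 0 := by linear_combination ht
      rw [h1] at hd
      rw [eq_mul_inv_iff_mul_eq]
      apply sl_ext
      simp only [mul_val]
      apply m2_ext <;> simp [mul_ap, E12] <;> field_simp <;> grind

lemma trace_conj (P h : SL2 F) : (P * h * P⁻¹).1.trace = h.1.trace := by
  rw [mul_val, Matrix.trace_mul_comm, mul_val, ← mul_assoc, inv_mul_val, one_mul]

/-- The Borel subgroup attached to `P`. -/
def Bor (P : SL2 F) : Subgroup (SL2 F) := UT.comap (MulAut.conj P⁻¹).toMonoidHom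

lemma mem_Bor {P h : SL2 F} : h ∈ Bor P ↔ (P⁻¹ * h * P).1 1 0 = 0 := by
  rw [Bor, Subgroup.mem_comap]
  simp [mem_UT]

lemma mem_Bor_iff {P u : SL2 F} {l : F} (hl : l ≠ 0) (hu : u = P * E12 l * P⁻¹) (h : SL2 F) :
    h ∈ Bor P ↔ (u * h).1.trace = h.1.trace := by
  have e1 : (u * h).1.trace = (E12 l * (P⁻¹ * h * P)).1.trace := by
    rw [← trace_conj P (E12 l * (P⁻¹ * h * P)), hu]
    refine congrArg (fun g : SL2 F => g.1.trace) ?_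
    simp [mul_assoc]
  have e2 : h.1.trace = (P⁻¹ * h * P).1.trace := by
    rw [← trace_conj P (P⁻¹ * h * P)]
    refine congrArg (fun g : SL2 F => g.1.trace) ?_
    simp [mul_assoc]
  rw [mem_Bor, e1, e2]
  generalize P⁻¹ * h * P = k
  rw [mul_val, Matrix.trace_fin_two, Matrix.trace_fin_two, mul_ap, mul_ap]
  simp [E12]
  simp [hl]

lemma Bor_solv (P : SL2 F) : Group.IsSolvable (Bor P) := by
  have := UT_solv (F := F)
  let f : Bor P →* (UT : Subgroup (SL2 F)) := (MulAut.conj P⁻¹).toMonoidHom.subgroupComap UT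
  refine Group.isSolvable_of_isSolvable_injective (f := f) ?_
  intro a b h
  have := congrArg Subtype.val h
  apply Subtype.ext
  exact (MulAut.conj P⁻¹).injective this

lemma Bor_ne_top (P : SL2 F) : Bor P ≠ ⊤ := by
  intro h
  have : P * E21 1 * P⁻¹ ∈ Bor P := by rw [h]; trivial
  rw [mem_Bor] at this
  have e : P⁻¹ * (P * E21 1 * P⁻¹) * P = E21 1 := by simp [mul_assoc]
  rw [e] at this
  simp [E21] at this

/-- elements of a Borel subgroup have square discriminant. -/
lemma Bor_disc {P h : SL2 F} (hh : h ∈ Bor P) : IsSquare (h.1.trace ^ 2 - 4) := by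
  have e2 : h.1.trace = (P⁻¹ * h * P).1.trace := by
    rw [← trace_conj P (P⁻¹ * h * P)]
    refine congrArg (fun g : SL2 F => g.1.trace) ?_
    simp [mul_assoc]
  rw [mem_Bor] at hh
  rw [e2]
  have := sl_det (P⁻¹ * h * P)
  generalize P⁻¹ * h * P = k at *
  rw [hh] at this
  refine ⟨k.1 0 0 - k.1 1 1, ?_⟩
  rw [Matrix.trace_fin_two]
  linear_combination 4 * this

lemma Bor_comm {P a b : SL2 F} (ha : a ∈ Bor P) (hb : b ∈ Bor P) :
    (a.1 * b.1 - b.1 * a.1).det = 0 := by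
  rw [mem_Bor] at ha hb
  have e : a.1 * b.1 - b.1 * a.1 = P.1 * ((P⁻¹ * a * P).1 * (P⁻¹ * b * P).1 -
      (P⁻¹ * b * P).1 * (P⁻¹ * a * P).1) * (P⁻¹).1 := by
    rw [mul_sub, sub_mul]
    rw [← mul_val, ← mul_val, ← mul_val, ← mul_val, ← mul_val, ← mul_val, ← mul_val, ← mul_val]
    refine congrArg₂ (fun a b : SL2 F => a.1 - b.1) ?_ ?_
    · simp [mul_assoc]
    · simp [mul_assoc]
  rw [e, Matrix.det_mul, Matrix.det_mul]
  generalize P⁻¹ * a * P = k at *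
  generalize P⁻¹ * b * P = k' at *
  have : (k.1 * k'.1 - k'.1 * k.1).det = 0 := by
    rw [Matrix.det_fin_two]
    simp [mul_ap, ha, hb]
    left
    ring
  rw [this]; simp

lemma gen_top {H : Subgroup (SL2 F)} (h12 : ∀ t, E12 t ∈ H) (h21 : ∀ t, E21 t ∈ H) : H = ⊤ := by
  have key : ∀ g : SL2 F, g.1 1 0 ≠ 0 → g ∈ H := by
    intro g hg
    have hd := sl_det g
    have : g = E12 ((g.1 0 0 - 1) / g.1 1 0) * E21 (g.1 1 0) * E12 ((g.1 1 1 - 1) / g.1 1 0) := by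
      apply sl_ext
      simp only [mul_val]
      apply m2_ext <;> simp [mul_ap, E12, E21] <;> field_simp <;> grind
    rw [this]
    exact H.mul_mem (H.mul_mem (h12 _) (h21 _)) (h12 _)
  rw [eq_top_iff]
  intro g _
  by_cases hg : g.1 1 0 = 0
  · have : g * E21 1 ∈ H := by
      apply key
      have hd := sl_det g
      rw [mul_val, mul_ap]
      simp [E21, hg]
      intro h
      rw [h, hg] at hd
      simp at hd
    have h3 := H.mul_mem this (H.inv_mem (h21 1))
    simpa using h3
  · exact key g hg

end borel

lemma gen_top_p {p : ℕ} [Fact p.Prime] {H : Subgroup (SL2 (ZMod p))} {l : ZMod p} (hl : l ≠ 0)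
    (hu : E12 l ∈ H) {h : SL2 (ZMod p)} (hh : h ∈ H) (hc : h.1 1 0 ≠ 0) : H = ⊤ := by
  have h12 : ∀ t, E12 t ∈ H := by
    intro t
    have := H.pow_mem hu (t / l).val
    rw [E12_pow, ZMod.natCast_val, ZMod.cast_id, div_mul_cancel₀ _ hl] at this
    exact this
  apply gen_top h12
  have hw : mk 0 (-1 / h.1 1 0) (h.1 1 0) 0 (by field_simp; ring) ∈ H := by
    have := H.mul_mem (H.mul_mem (h12 (-h.1 0 0 / h.1 1 0)) hh) (h12 (-h.1 1 1 / h.1 1 0))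
    convert this using 1
    have hd := sl_det h
    apply sl_ext
    simp only [mul_val]
    simp only [m2_ext_iff, mul_ap]
    simp [E12]
    field_simp
    grind
  intro t
  have := H.mul_mem (H.mul_mem hw (h12 (-t / (h.1 1 0) ^ 2))) (H.inv_mem hw)
  convert this using 1
  apply sl_ext
  simp only [mul_val, inv_val]
  apply m2_ext <;> simp [mul_ap, E12, E21] <;> try field_simp

/-- L1. -/
lemma top_of_unip {p : ℕ} [Fact p.Prime] {H : Subgroup (SL2 (ZMod p))} {u h : SL2 (ZMod p)}
    (hu : u ∈ H) (hut : u.1.trace = 2) (hu1 : u ≠ 1) (hh : h ∈ H)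
    (hne : (u * h).1.trace ≠ h.1.trace) : H = ⊤ := by
  obtain ⟨P, l, hl, rfl⟩ := unip_conj hut hu1
  rw [Ne, ← mem_Bor_iff hl rfl, mem_Bor] at hne
  have : H.comap (MulAut.conj P).toMonoidHom = ⊤ := by
    apply gen_top_p hl (h := P⁻¹ * h * P)
    · rw [Subgroup.mem_comap]; simpa using hu
    · rw [Subgroup.mem_comap]
      have : (MulAut.conj P).toMonoidHom (P⁻¹ * h * P) = h := by simp [mul_assoc]
      rw [this]; exact hh
    · exact hne
  rw [eq_top_iff]
  intro g _
  have hg : P⁻¹ * g * P ∈ H.comap (MulAut.conj P).toMonoidHom := by rw [this]; trivial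
  rw [Subgroup.mem_comap] at hg
  have e : (MulAut.conj P).toMonoidHom (P⁻¹ * g * P) = g := by simp [mul_assoc]
  rwa [e] at hg

end PSLsol


namespace PSLsol
open Matrix
set_option linter.unusedSectionVars false

section classify
variable {p : ℕ} [hpF : Fact p.Prime]

lemma natCast_ne {n : ℕ} (h : ∀ q, q.Prime → q ∣ n → q < p) : (n : ZMod p) ≠ 0 := by
  intro e
  rw [ZMod.natCast_eq_zero_iff] at e
  exact lt_irrefl _ (h p hpF.out e)

lemma two_ne (h5 : 5 < p) : (2 : ZMod p) ≠ 0 := by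
  intro e
  have : ((2 : ℕ) : ZMod p) = 0 := by exact_mod_cast e
  rw [ZMod.natCast_eq_zero_iff] at this
  have := Nat.le_of_dvd (by norm_num) this
  omega

lemma three_ne (h5 : 5 < p) : (3 : ZMod p) ≠ 0 := by
  intro e
  have : ((3 : ℕ) : ZMod p) = 0 := by exact_mod_cast e
  rw [ZMod.natCast_eq_zero_iff] at this
  have := Nat.le_of_dvd (by norm_num) this
  omega

variable (p) in
abbrev Kp := AlgebraicClosure (ZMod p)

variable (p) in
noncomputable def io : SL2 (ZMod p) →* SL2 (Kp p) :=
  Matrix.SpecialLinearGroup.map (algebraMap (ZMod p) (Kp p))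

lemma io_val (x : SL2 (ZMod p)) : (io p x).1 = x.1.map (algebraMap (ZMod p) (Kp p)) := rfl

lemma io_trace (x : SL2 (ZMod p)) : (io p x).1.trace = algebraMap (ZMod p) (Kp p) x.1.trace := by
  rw [io_val, Matrix.trace_fin_two, Matrix.trace_fin_two]; simp

lemma io_inj : Function.Injective (io p) := by
  intro x y h
  have h' : (io p x).1 = (io p y).1 := by rw [h]
  apply sl_ext
  rw [io_val, io_val] at h'
  exact Matrix.map_injective (algebraMap (ZMod p) (Kp p)).injective h'

lemma io_neg : io p (-1) = -1 := by
  apply sl_ext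
  rw [io_val]
  apply m2_ext <;> simp

lemma io_NC {x : SL2 (ZMod p)} (h : NC x) : NC (io p x) :=
  ⟨fun e => h.1 (io_inj (by rw [e, map_one])), fun e => h.2 (io_inj (by rw [e, io_neg]))⟩

lemma two_ne_K (h5 : 5 < p) : (2 : Kp p) ≠ 0 := by
  intro e
  apply two_ne h5
  apply (algebraMap (ZMod p) (Kp p)).injective
  rw [map_zero, map_ofNat]; exact e

lemma card_five (hmod : p % 5 = 2 ∨ p % 5 = 3) (H : Subgroup (SL2 (ZMod p))) : ¬ 5 ∣ Nat.card H := by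
  intro h
  have h1 : 5 ∣ Nat.card (SL2 (ZMod p)) := h.trans (Subgroup.card_subgroup_dvd_card H)
  have h2 : Nat.card (SL2 (ZMod p)) ∣ Nat.card (GL (Fin 2) (ZMod p)) :=
    Subgroup.card_dvd_of_injective (Matrix.SpecialLinearGroup.toGL (n := Fin 2) (R := ZMod p))
      Matrix.SpecialLinearGroup.toGL_injective
  have h3 := h1.trans h2
  rw [Matrix.card_GL_field, Fin.prod_univ_two, ZMod.card] at h3
  have h5 : Nat.Prime 5 := by norm_num
  have hp1 : 1 ≤ p := hpF.out.one_le
  rcases (Nat.Prime.dvd_mul h5).1 h3 with h | h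
  · simp at h
    have e : p ^ 2 - 1 + 1 = p ^ 2 := Nat.sub_add_cancel (Nat.one_le_pow _ _ hp1)
    have e2 : p ^ 2 % 5 = 4 := by
      rcases hmod with hm | hm <;> rw [Nat.pow_mod, hm]
    omega
  · simp at h
    have e : p ^ 2 - p + p = p ^ 2 := Nat.sub_add_cancel (by nlinarith)
    have e2 : p ^ 2 % 5 = 4 := by
      rcases hmod with hm | hm <;> rw [Nat.pow_mod, hm]
    omega

lemma trace_two_or {F : Type*} [Field F] {t : F} (h : t ^ 2 = 4) : t = 2 ∨ t = -2 := by
  have : (t - 2) * (t + 2) = 0 := by linear_combination h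
  rcases mul_eq_zero.1 this with e | e
  · left; linear_combination e
  · right; linear_combination e

/-- L2: classification of proper subgroups containing `-1`. -/
theorem classify (h5 : 5 < p) (hmod : p % 5 = 2 ∨ p % 5 = 3) (H : Subgroup (SL2 (ZMod p)))
    (hneg : -1 ∈ H) (htop : H ≠ ⊤) :
    (∃ P, H ≤ Bor P ∧ ∃ u ∈ H, u.1.trace = 2 ∧ u ≠ 1 ∧
      ∀ h, h ∈ Bor P ↔ (u * h).1.trace = h.1.trace) ∨
    ((∀ h ∈ H, h.1.trace ^ 2 = 4 → h = 1 ∨ h = -1) ∧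
      ((∃ Z : M2 (Kp p), Z * Z = 1 ∧ Z.trace = 0 ∧ ∀ h ∈ H, CA (io p h).1 Z) ∨
       (Group.IsSolvable H ∧ ∀ h ∈ H, NC h →
          h.1.trace ^ 2 = 0 ∨ h.1.trace ^ 2 = 1 ∨ h.1.trace ^ 2 = 2))) := by
  by_cases hu : ∃ u ∈ H, u.1.trace = 2 ∧ u ≠ 1
  · left
    obtain ⟨u, huH, hut, hu1⟩ := hu
    obtain ⟨P, l, hl, e⟩ := unip_conj hut hu1
    refine ⟨P, fun h hh => ?_, u, huH, hut, hu1, mem_Bor_iff hl e⟩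
    rw [mem_Bor_iff hl e]
    by_contra hne
    exact htop (top_of_unip huH hut hu1 hh hne)
  · right
    have hss : ∀ h ∈ H, h.1.trace ^ 2 = 4 → h = 1 ∨ h = -1 := by
      intro h hh ht
      by_contra hcon
      push Not at hcon
      rcases trace_two_or ht with e | e
      · exact hu ⟨h, hh, e, hcon.1⟩
      · refine hu ⟨-h, ?_, ?_, ?_⟩
        · have := H.mul_mem hneg hh; simpa using this
        · rw [neg_val, Matrix.trace_neg, e, neg_neg]
        · intro e; apply hcon.2; rw [← e, neg_neg]
    refine ⟨hss, ?_⟩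
    let H' := H.map (io p)
    have : Finite H' := Finite.of_equiv H (H.equivMapOfInjective (io p) io_inj).toEquiv
    have hcard : Nat.card H' = Nat.card H :=
      (Nat.card_congr (H.equivMapOfInjective (io p) io_inj).toEquiv).symm
    have key := count_XS (two_ne_K h5) H' ⟨-1, hneg, io_neg⟩ (by
      rintro _ ⟨h, hh, rfl⟩ ht
      rw [io_trace, ← map_pow] at ht
      have : h.1.trace ^ 2 = 4 := by
        apply (algebraMap (ZMod p) (Kp p)).injective
        rw [ht, map_ofNat]
      rcases hss h hh this with rfl | rfl
      · left; simp
      · right; exact io_neg)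
    rw [hcard] at key
    rcases key with ⟨Z, h1, h2, h3⟩ | ⟨h1, h2⟩ | h1
    · left; exact ⟨Z, h1, h2, fun h hh => h3 _ ⟨h, hh, rfl⟩⟩
    · right
      refine ⟨solv_24_48 h1, fun h hh hn => ?_⟩
      have hp : h ^ 4 = 1 ∨ h ^ 6 = 1 ∨ h ^ 8 = 1 := by
        rcases h2 _ ⟨h, hh, rfl⟩ (io_NC hn) with e | e | e
        · left; apply io_inj; rw [map_pow, e, map_one]
        · right; left; apply io_inj; rw [map_pow, e, map_one]
        · right; right; apply io_inj; rw [map_pow, e, map_one]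
      exact trace_of_pow (two_ne h5) hn hp
    · exact absurd h1 (card_five hmod H)

lemma solv_of_ne_top (h5 : 5 < p) (hmod : p % 5 = 2 ∨ p % 5 = 3) (H : Subgroup (SL2 (ZMod p)))
    (hneg : -1 ∈ H) (htop : H ≠ ⊤) : Group.IsSolvable H := by
  rcases classify h5 hmod H hneg htop with ⟨P, hP, -⟩ | ⟨-, ⟨Z, hZ, ht, hC⟩ | ⟨hs, -⟩⟩
  · have := Bor_solv P
    exact Group.isSolvable_of_isSolvable_injective (f := Subgroup.inclusion hP)
      (Subgroup.inclusion_injective hP)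
  · have hns := Z_nonscalar (two_ne_K h5) (ne_zero_of_sq hZ) ht
    let C : Subgroup H :=
      { carrier := {h | (io p h.1).1 * Z = Z * (io p h.1).1}
        one_mem' := by simp
        mul_mem' := by
          intro a b ha hb
          simp only [Set.mem_ofPred_eq] at *
          rw [Subgroup.coe_mul, map_mul, mul_val, mul_assoc, hb, ← mul_assoc, ha, mul_assoc]
        inv_mem' := by
          intro a ha
          simp only [Set.mem_ofPred_eq] at *
          have e1 := inv_mul_val (io p a.1)
          have e2 := mul_inv_val (io p a.1)
          rw [Subgroup.coe_inv, map_inv]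
          calc ((io p a.1)⁻¹).1 * Z = ((io p a.1)⁻¹).1 * (Z * (io p a.1).1) * ((io p a.1)⁻¹).1 := by
                rw [mul_assoc, mul_assoc, e2, mul_one]
            _ = _ := by rw [← ha, ← mul_assoc, e1, one_mul] }
    apply solv_of_comm_sub C
    · intro a b
      show (io p (a.1 * b.1 * (a.1)⁻¹ * (b.1)⁻¹)).1 * Z = Z * (io p (a.1 * b.1 * (a.1)⁻¹ * (b.1)⁻¹)).1
      rw [map_mul, map_mul, map_mul, map_inv, map_inv]
      generalize hA : io p a.1 = A
      generalize hB : io p b.1 = B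
      have cA : CA A.1 Z := by rw [← hA]; exact hC _ a.2
      have cB : CA B.1 Z := by rw [← hB]; exact hC _ b.2
      have key : (A * B * A⁻¹ * B⁻¹) * (B * A) = A * B := by simp [mul_assoc]
      have kk : (A * B * A⁻¹ * B⁻¹).1 * (B.1 * A.1) = A.1 * B.1 := by
        rw [← mul_val B, ← mul_val _ (B * A), key]; rfl
      have inv : (B * A).1 * ((B * A)⁻¹).1 = 1 := mul_inv_val _
      have : ∀ X Y : M2 (Kp p), X * (B * A).1 = Y * (B * A).1 → X = Y := by
        intro X Y h
        have := congrArg (fun W => W * ((B * A)⁻¹).1) h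
        simpa only [mul_assoc, inv, mul_one] using this
      apply this
      rw [mul_assoc Z, mul_val B A, kk, mul_assoc]
      rcases cA with cA | cA <;> rcases cB with cB | cB
      · have : Z * (B.1 * A.1) = (B.1 * A.1) * Z := by
          rw [← mul_assoc, ← cB, mul_assoc, ← cA, mul_assoc]
        rw [this, ← mul_assoc, kk, mul_assoc, cB, ← mul_assoc, cA, mul_assoc]
      · have : Z * (B.1 * A.1) = -((B.1 * A.1) * Z) := by
          rw [← mul_assoc, ← neg_eq_iff_eq_neg.2 cB, neg_mul, mul_assoc, ← cA, mul_assoc]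
        rw [this, mul_neg, ← mul_assoc, kk, mul_assoc, cB, mul_neg, ← mul_assoc, cA, mul_assoc, neg_neg]
      · have : Z * (B.1 * A.1) = -((B.1 * A.1) * Z) := by
          rw [← mul_assoc, ← cB, mul_assoc, ← neg_eq_iff_eq_neg.2 cA, mul_neg, mul_assoc]
        rw [this, mul_neg, ← mul_assoc, kk, mul_assoc, cB, ← mul_assoc, cA, neg_mul, mul_assoc, neg_neg]
      · have : Z * (B.1 * A.1) = ((B.1 * A.1) * Z) := by
          rw [← mul_assoc, ← neg_eq_iff_eq_neg.2 cB, neg_mul, mul_assoc, ← neg_eq_iff_eq_neg.2 cA,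
            mul_neg, mul_assoc, neg_neg]
        rw [this, ← mul_assoc, kk, mul_assoc, cB, mul_neg, ← mul_assoc, cA, neg_mul, mul_assoc, neg_neg]
    · intro a ha b hb
      apply Subtype.ext
      apply io_inj
      apply sl_ext
      rw [Subgroup.coe_mul, Subgroup.coe_mul, map_mul, map_mul, mul_val, mul_val]
      exact comm_trans hns ha hb
  · exact hs

/-- `Sv a b`: the images of `a`, `b` generate a solvable (equivalently proper) subgroup. -/
def Sv (a b : SL2 (ZMod p)) : Prop := Subgroup.closure ({a, b, -1} : Set (SL2 (ZMod p))) ≠ ⊤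

lemma center_le {a b : SL2 (ZMod p)} :
    Subgroup.center (SL2 (ZMod p)) ≤ Subgroup.closure ({a, b, -1} : Set (SL2 (ZMod p))) := by
  intro z hz
  obtain ⟨r, hr, hz⟩ := Matrix.SpecialLinearGroup.mem_center_iff.1 hz
  have : r = 1 ∨ r = -1 := by
    rw [Fintype.card_fin] at hr
    exact sq_eq_one_iff.1 hr
  rcases this with rfl | rfl
  · have : z = 1 := by apply sl_ext; rw [← hz]; simp
    rw [this]; exact one_mem _
  · have : z = -1 := by apply sl_ext; rw [← hz, neg_val]; apply m2_ext <;> simp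
    rw [this]; exact Subgroup.subset_closure (by simp)

lemma neg_one_center : (-1 : SL2 (ZMod p)) ∈ Subgroup.center (SL2 (ZMod p)) := by
  rw [Subgroup.mem_center_iff]; intro g; simp

lemma Sv_iff (h5 : 5 < p) (hmod : p % 5 = 2 ∨ p % 5 = 3) (a b : SL2 (ZMod p)) :
    Group.IsSolvable (Subgroup.closure ({(QuotientGroup.mk a : SL2 (ZMod p) ⧸
      Subgroup.center (SL2 (ZMod p))), QuotientGroup.mk b} : Set _)) ↔ Sv a b := by
  let π := QuotientGroup.mk' (Subgroup.center (SL2 (ZMod p)))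
  have hπ : Function.Surjective π := QuotientGroup.mk'_surjective _
  have hmap : (Subgroup.closure ({a, b, -1} : Set (SL2 (ZMod p)))).map π =
      Subgroup.closure {(QuotientGroup.mk a : SL2 (ZMod p) ⧸
      Subgroup.center (SL2 (ZMod p))), QuotientGroup.mk b} := by
    rw [MonoidHom.map_closure]
    apply le_antisymm
    · rw [Subgroup.closure_le]
      rintro _ ⟨z, hz, rfl⟩
      rcases hz with rfl | rfl | rfl
      · exact Subgroup.subset_closure (by simp [π])
      · exact Subgroup.subset_closure (by simp [π])
      · have : π (-1) = 1 := (QuotientGroup.eq_one_iff _).2 neg_one_center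
        rw [this]; exact one_mem _
    · apply Subgroup.closure_mono
      rintro z (rfl | rfl)
      · exact ⟨a, by simp, rfl⟩
      · exact ⟨b, by simp, rfl⟩
  rw [← hmap]
  constructor
  · intro hs htop
    rw [htop, Subgroup.map_top_of_surjective π hπ] at hs
    have h2 : (2 : ZMod p) ^ 2 ≠ 1 := by
      intro e
      apply three_ne h5
      linear_combination e
    have : Group.IsPerfect (SL2 (ZMod p)) := ⟨SL2.commutator_eq_top (two_ne h5) h2⟩
    have : Group.IsPerfect (SL2 (ZMod p) ⧸ Subgroup.center (SL2 (ZMod p))) := inferInstance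
    have hnt : Nontrivial (SL2 (ZMod p) ⧸ Subgroup.center (SL2 (ZMod p))) := by
      refine ⟨π (E12 1), 1, ?_⟩
      intro e
      have := (QuotientGroup.eq_one_iff _).1 e
      rw [Subgroup.mem_center_iff] at this
      have := congrArg (fun g : SL2 (ZMod p) => g.1 0 0) (this (E21 1))
      simp [E12, E21] at this
    apply Group.IsPerfect.not_isSolvable (SL2 (ZMod p) ⧸ Subgroup.center (SL2 (ZMod p)))
    let e : (⊤ : Subgroup (SL2 (ZMod p) ⧸ Subgroup.center (SL2 (ZMod p)))) ≃* _ := Subgroup.topEquiv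
    exact Group.isSolvable_of_surjective (f := e.toMonoidHom) e.surjective
  · intro htop
    have := solv_of_ne_top h5 hmod _ (Subgroup.subset_closure (by simp)) htop
    exact Group.isSolvable_of_surjective (π.subgroupMap_surjective _)

lemma Sv_of_sub {H : Subgroup (SL2 (ZMod p))} (hneg : -1 ∈ H) (htop : H ≠ ⊤) {a b : SL2 (ZMod p)}
    (ha : a ∈ H) (hb : b ∈ H) : Sv a b := by
  intro e
  apply htop
  rw [eq_top_iff, ← e, Subgroup.closure_le]
  rintro z (rfl | rfl | rfl) <;> assumption

end classify
end PSLsol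


namespace PSLsol
open Matrix
set_option linter.unusedSectionVars false

section steps
variable {p : ℕ} [hpF : Fact p.Prime]

lemma Sv_comm {a b : SL2 (ZMod p)} : Sv a b ↔ Sv b a := by
  unfold Sv; rw [Set.insert_comm]

/-- the group `closure {a, b, -1}` -/
def LL (a b : SL2 (ZMod p)) : Subgroup (SL2 (ZMod p)) :=
  Subgroup.closure ({a, b, -1} : Set (SL2 (ZMod p)))

lemma LL_l (a b : SL2 (ZMod p)) : a ∈ LL a b := Subgroup.subset_closure (by simp)
lemma LL_r (a b : SL2 (ZMod p)) : b ∈ LL a b := Subgroup.subset_closure (by simp)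
lemma LL_n (a b : SL2 (ZMod p)) : -1 ∈ LL a b := Subgroup.subset_closure (by simp)
lemma Sv_LL {a b : SL2 (ZMod p)} : Sv a b ↔ LL a b ≠ ⊤ := Iff.rfl

lemma neg_mem_of {H : Subgroup (SL2 (ZMod p))} (hneg : -1 ∈ H) {a : SL2 (ZMod p)} (h : a ∈ H) :
    -a ∈ H := by
  have := H.mul_mem hneg h; simpa using this

lemma neg_mem_iff' {H : Subgroup (SL2 (ZMod p))} (hneg : -1 ∈ H) {a : SL2 (ZMod p)} :
    -a ∈ H ↔ a ∈ H :=
  ⟨fun h => by have := neg_mem_of hneg h; simpa using this, neg_mem_of hneg⟩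

lemma Sv_neg_l {a b : SL2 (ZMod p)} : Sv (-a) b ↔ Sv a b := by
  constructor
  · intro h
    refine Sv_of_sub (LL_n (-a) b) h ?_ (LL_r _ _)
    exact (neg_mem_iff' (LL_n (-a) b)).1 (LL_l _ _)
  · intro h
    refine Sv_of_sub (LL_n a b) h ?_ (LL_r _ _)
    exact neg_mem_of (LL_n a b) (LL_l _ _)

lemma neg_mem_NZ (Z : M2 (ZMod p)) : -1 ∈ NZ Z := Or.inl (by simp)

lemma Sv_of_comm (h5 : 5 < p) {a b : SL2 (ZMod p)} (ha : NC a) (h : b * a = a * b) : Sv a b :=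
  Sv_of_sub (neg_mem_NZ (tl a)) (NZ_ne_top (two_ne h5) (tl_ne (two_ne h5) ha) (tl_trace a))
    (Or.inl ((tl_comm_iff (two_ne h5) a a).2 rfl)) (Or.inl ((tl_comm_iff (two_ne h5) a b).2 h))

lemma sq_of_trace_zero {a : SL2 (ZMod p)} (ha : a.1.trace = 0) : a.1 * a.1 = -1 := by
  rw [sl_sq, ha]; simp

lemma NC_of_trace_zero (h5 : 5 < p) {a : SL2 (ZMod p)} (ha : a.1.trace = 0) : NC a := by
  have h2 := two_ne h5
  constructor
  · rintro rfl
    simp at ha; exact h2 ha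
  · rintro rfl
    simp at ha; exact h2 ha

/-- D -/
lemma Sv_of_trace_zero (h5 : 5 < p) {a b : SL2 (ZMod p)} (ha : a.1.trace = 0) (hb : b.1.trace = 0) :
    Sv a b := by
  by_cases h : b * a = a * b
  · exact Sv_of_comm h5 (NC_of_trace_zero h5 ha) h
  · have hZ : a.1 * b.1 - b.1 * a.1 ≠ 0 := by
      intro e
      apply h
      apply sl_ext
      rw [sub_eq_zero] at e
      exact e.symm
    have ea := sq_of_trace_zero ha
    have eb := sq_of_trace_zero hb
    refine Sv_of_sub (neg_mem_NZ (a.1 * b.1 - b.1 * a.1)) (NZ_ne_top (two_ne h5) hZ ?_)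
      (Or.inr ?_) (Or.inr ?_)
    · rw [Matrix.trace_sub, Matrix.trace_mul_comm, sub_self]
    · rw [mul_sub, sub_mul, mul_assoc b.1, ea, ← mul_assoc, ea]
      simp [mul_assoc]
      try abel
    · rw [mul_sub, sub_mul, mul_assoc a.1, eb, ← mul_assoc b.1 b.1, eb]
      simp [mul_assoc]
      try abel

lemma Sv_of_mul {a b : SL2 (ZMod p)} (h : Sv a (a * b)) : Sv a b := by
  refine Sv_of_sub (LL_n a (a * b)) h (LL_l _ _) ?_
  have := (LL a (a * b)).mul_mem ((LL a (a * b)).inv_mem (LL_l _ _)) (LL_r a (a * b))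
  simpa using this

lemma neg_mem_Bor (P : SL2 (ZMod p)) : -1 ∈ Bor P := by
  rw [mem_Bor]; simp

lemma trace_mul_self {F : Type*} [Field F] (u : SL2 F) : (u * u).1.trace = u.1.trace ^ 2 - 2 := by
  rw [mul_val, sl_sq]; simp [Matrix.trace_sub]; ring

/-- F1 -/
lemma Sv_unip {u : SL2 (ZMod p)} (hut : u.1.trace = 2) (hu1 : u ≠ 1) (x : SL2 (ZMod p)) :
    Sv x u ↔ (u * x).1.trace = x.1.trace := by
  constructor
  · intro h
    by_contra hne
    exact h (top_of_unip (LL_r x u) hut hu1 (LL_l x u) hne)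
  · intro h
    obtain ⟨P, l, hl, e⟩ := unip_conj hut hu1
    refine Sv_of_sub (neg_mem_Bor P) (Bor_ne_top P) ((mem_Bor_iff hl e x).2 h)
      ((mem_Bor_iff hl e u).2 ?_)
    rw [trace_mul_self, hut]; ring

/-- E1, first case -/
lemma exists_E1_aux (h5 : 5 < p) {y : SL2 (ZMod p)} (ht : y.1.trace ^ 2 ≠ 4) (hc : y.1 1 0 ≠ 0) :
    ∃ g : SL2 (ZMod p), g.1.trace = 0 ∧ (y * g).1.trace = 2 := by
  have h2 := two_ne h5
  have hd := sl_det y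
  rw [Matrix.trace_fin_two] at ht
  set a := y.1 0 0 with ha
  set b := y.1 0 1 with hb
  set c := y.1 1 0 with hc'
  set d := y.1 1 1 with hd'
  have hD : (a + d) ^ 2 - 4 ≠ 0 := sub_ne_zero.2 ht
  open Polynomial in
  obtain ⟨w, γ, h⟩ := FiniteField.exists_root_sum_quadratic (R := ZMod p)
    (f := C 1 * X ^ 2 + C 0 * X + C 0)
    (g := C (-((a + d) ^ 2 - 4)) * X ^ 2 + C (8 * c) * X + C (4 * c ^ 2))
    (degree_quadratic one_ne_zero) (degree_quadratic (neg_ne_zero.2 hD))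
    (by rw [ZMod.card]; exact (hpF.out.eq_two_or_odd.resolve_left (by omega)))
  simp at h
  have hal : ∃ α, 2 * c * α = w + (a - d) * γ := ⟨(w + (a - d) * γ) / (2 * c), by field_simp⟩
  obtain ⟨α, hα⟩ := hal
  obtain ⟨β, hβ⟩ : ∃ β, c * β = 2 - (a - d) * α - b * γ := ⟨_, mul_div_cancel₀ _ hc⟩
  have hw : w = 2 * c * α - (a - d) * γ := by linear_combination -hα
  have hdet : α * (-α) - β * γ = 1 := by
    have h4 : (4 * c) * (c * (α * (-α) - β * γ - 1)) = 0 := by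
      rw [hw] at h
      linear_combination (-1) * h - 4 * c * γ * hβ - 4 * γ ^ 2 * hd
    have h4c : (4 : ZMod p) * c ≠ 0 := by
      have : (4 : ZMod p) = 2 * 2 := by norm_num
      rw [this]; exact mul_ne_zero (mul_ne_zero h2 h2) hc
    have := (mul_eq_zero.1 ((mul_eq_zero.1 h4).resolve_left h4c)).resolve_left hc
    linear_combination this
  refine ⟨mk α β γ (-α) hdet, ?_, ?_⟩
  · simp [Matrix.trace_fin_two]
  · rw [mul_val, Matrix.trace_fin_two, mul_ap, mul_ap, ← ha, ← hb, ← hc', ← hd']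
    simp
    linear_combination hβ

lemma exists_E1 (h5 : 5 < p) {y : SL2 (ZMod p)} (ht : y.1.trace ^ 2 ≠ 4) :
    ∃ g : SL2 (ZMod p), g.1.trace = 0 ∧ (y * g).1.trace = 2 := by
  by_cases hc : y.1 1 0 = 0
  · by_cases hb : y.1 0 1 = 0
    · have hd := sl_det y
      rw [hb] at hd
      rw [Matrix.trace_fin_two] at ht
      have had : y.1 0 0 - y.1 1 1 ≠ 0 := by
        intro e
        apply ht
        have e' : y.1 1 1 = y.1 0 0 := by linear_combination -e
        rw [e'] at hd ⊢
        linear_combination 4 * hd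
      set α := 2 / (y.1 0 0 - y.1 1 1) with hα
      refine ⟨mk α 1 (-1 - α ^ 2) (-α) (by ring), by simp [Matrix.trace_fin_two], ?_⟩
      rw [mul_val, Matrix.trace_fin_two, mul_ap, mul_ap]
      simp [hb, hc]
      rw [hα]
      field_simp
      try ring
    · let y' : SL2 (ZMod p) := ⟨y.1ᵀ, by rw [Matrix.det_transpose]; exact y.2⟩
      obtain ⟨g, hg, hg2⟩ := exists_E1_aux h5 (y := y') (by
        show (y.1ᵀ).trace ^ 2 ≠ 4; rw [Matrix.trace_transpose]; exact ht) hb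
      refine ⟨⟨g.1ᵀ, by rw [Matrix.det_transpose]; exact g.2⟩, ?_, ?_⟩
      · show (g.1ᵀ).trace = 0
        rw [Matrix.trace_transpose]; exact hg
      · show (y.1 * g.1ᵀ).trace = 2
        rw [← hg2]
        show (y.1 * g.1ᵀ).trace = (y.1ᵀ * g.1).trace
        rw [← Matrix.trace_transpose, Matrix.transpose_mul, Matrix.transpose_transpose,
          Matrix.trace_mul_comm]
  · exact exists_E1_aux h5 ht hc

lemma trace_inv {F : Type*} [Field F] (x : SL2 F) : (x⁻¹).1.trace = x.1.trace := by
  rw [inv_val']; simp [Matrix.trace_sub]; ring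

/-- Third step, first part -/
lemma trace_zero_of (h5 : 5 < p) {x y : SL2 (ZMod p)} (hs : ∀ g, Sv x g → Sv y g)
    (hy : y.1.trace ^ 2 ≠ 4) (hx0 : x.1.trace = 0) : y.1.trace = 0 := by
  by_contra hy0
  obtain ⟨g, hg, hg2⟩ := exists_E1 h5 hy
  refine hs g (Sv_of_trace_zero h5 hx0 hg) ?_
  have hu1 : y * g ≠ 1 := by
    intro e
    apply hy0
    rw [eq_inv_of_mul_eq_one_left e, trace_inv, hg]
  refine top_of_unip (u := y * g) (h := g) ((LL y g).mul_mem (LL_l _ _) (LL_r _ _)) hg2 hu1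
    (LL_r _ _) ?_
  rw [mul_val, mul_val, mul_assoc, sq_of_trace_zero hg, hg]
  simpa using hy0

/-- Third step, second part, split case, half -/
lemma split_half {x y : SL2 (ZMod p)} (hs : ∀ g, Sv x g → Sv y g)
    {l l' : ZMod p} (h1 : l + l' = x.1.trace) (h2 : l * l' = 1) :
    (x.1 - l • 1) * y.1 * (x.1 - l' • 1) = 0 := by
  have hE : (x.1 - l • (1 : M2 (ZMod p))) * (x.1 - l' • 1) = 0 := by
    rw [sub_mul, mul_sub, mul_sub, sl_sq, ← h1]
    apply m2_ext <;> simp <;> first | ring1 | linear_combination h2 | linear_combination -h2 | grind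
  have hEx : (x.1 - l • (1 : M2 (ZMod p))) * x.1 = x.1 * (x.1 - l • (1 : M2 (ZMod p))) := by
    simp [sub_mul, mul_sub]
  set E := x.1 - l • (1 : M2 (ZMod p)) with hEd
  set E' := x.1 - l' • (1 : M2 (ZMod p)) with hEd'
  have key : ∀ k : M2 (ZMod p), (E * y.1 * E' * k).trace = 0 := by
    intro k
    set N := E' * k * E with hN
    have hNN : N * N = 0 := by
      calc N * N = E' * k * (E * E') * k * E := by rw [hN]; simp only [mul_assoc]
        _ = 0 := by rw [hE]; simp
    have hNt : N.trace = 0 := by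
      rw [hN, mul_assoc, Matrix.trace_mul_comm, mul_assoc, hE]; simp
    have hNdet : N.det = 0 := by
      have := congrArg Matrix.det hNN
      rw [Matrix.det_mul, Matrix.det_zero] at this
      exact mul_self_eq_zero.1 this
    have hudet : (1 + N).det = 1 := by
      rw [Matrix.det_fin_two] at hNdet ⊢
      rw [Matrix.trace_fin_two] at hNt
      simp
      linear_combination hNdet + hNt
    have hfin : (E * y.1 * E' * k).trace = (N * y.1).trace := by
      rw [hN]
      rw [show E * y.1 * E' * k = (E * y.1) * (E' * k) by simp only [mul_assoc],
        Matrix.trace_mul_comm]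
      simp only [mul_assoc]
    have hfx : (N * x.1).trace = 0 := by
      rw [hN, mul_assoc, hEx, Matrix.trace_mul_comm]
      rw [show x.1 * E * (E' * k) = x.1 * (E * E') * k by simp only [mul_assoc], hE]; simp
    rw [hfin]
    let u : SL2 (ZMod p) := ⟨1 + N, hudet⟩
    have hut : u.1.trace = 2 := by
      show (1 + N).trace = 2
      rw [Matrix.trace_add, hNt]; simp
    by_cases hu1 : u = 1
    · have : 1 + N = 1 := congrArg Subtype.val hu1
      have : N = 0 := by simpa using this
      rw [this]; simp
    · have hx := (Sv_unip hut hu1 x).2 (by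
        show ((1 + N) * x.1).trace = _
        rw [add_mul, one_mul, Matrix.trace_add, hfx, add_zero])
      have hy := (Sv_unip hut hu1 y).1 (hs u hx)
      change ((1 + N) * y.1).trace = _ at hy
      rw [add_mul, one_mul, Matrix.trace_add] at hy
      simpa using hy
  generalize E * y.1 * E' = W at key
  have k00 := key !![1, 0; 0, 0]
  have k01 := key !![0, 0; 1, 0]
  have k10 := key !![0, 1; 0, 0]
  have k11 := key !![0, 0; 0, 1]
  simp only [Matrix.trace_fin_two, mul_ap] at k00 k01 k10 k11
  simp at k00 k01 k10 k11
  apply m2_ext <;> simp [*]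

lemma split_comm (h5 : 5 < p) {x y : SL2 (ZMod p)} (hs : ∀ g, Sv x g → Sv y g)
    (hx : x.1.trace ^ 2 ≠ 4) (hsq : IsSquare (x.1.trace ^ 2 - 4)) : x * y = y * x := by
  obtain ⟨d, hd⟩ := hsq
  have h2 := two_ne h5
  have hd0 : d ≠ 0 := by
    rintro rfl
    apply hx
    linear_combination hd
  have h4 : ((x.1.trace + d) / 2) * ((x.1.trace - d) / 2) = 1 := by
    have : (4 : ZMod p) ≠ 0 := by
      have : (4 : ZMod p) = 2 * 2 := by norm_num
      rw [this]; exact mul_ne_zero h2 h2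
    field_simp
    linear_combination hd
  have e1 := split_half hs (l := (x.1.trace + d) / 2) (l' := (x.1.trace - d) / 2)
    (by field_simp; ring) h4
  have e2 := split_half hs (l := (x.1.trace - d) / 2) (l' := (x.1.trace + d) / 2)
    (by field_simp; ring) (by rw [mul_comm]; exact h4)
  have e3 : x.1 - ((x.1.trace - d) / 2) • (1 : M2 (ZMod p)) =
      (x.1 - ((x.1.trace + d) / 2) • (1 : M2 (ZMod p))) + d • 1 := by
    apply m2_ext <;> simp <;> field_simp <;> ring
  rw [e3] at e1 e2
  set E := x.1 - ((x.1.trace + d) / 2) • (1 : M2 (ZMod p)) with hE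
  have e4 : d • (E * y.1 - y.1 * E) = 0 := by
    have : d • (E * y.1 - y.1 * E) = E * y.1 * (E + d • 1) - (E + d • 1) * y.1 * E := by
      simp only [mul_add, add_mul, mul_smul_comm, smul_mul_assoc, mul_one, one_mul, smul_sub]
      abel
    rw [this, e1, e2, sub_zero]
  have e5 := (smul_eq_zero.1 e4).resolve_left hd0
  have e6 : x.1 * y.1 - y.1 * x.1 = E * y.1 - y.1 * E := by
    rw [hE]; simp [sub_mul, mul_sub]
  apply sl_ext
  rw [e5, sub_eq_zero] at e6
  exact e6

end steps
end PSLsol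


namespace PSLsol
open Matrix
set_option linter.unusedSectionVars false

section generic2
variable {F : Type*} [Field F]

/-- linear combination of `1, x, y, xy` -/
def cmb (x y : SL2 F) (a b c d : F) : M2 F := a • 1 + b • x.1 + c • y.1 + d • (x.1 * y.1)

lemma cmb_det (x y : SL2 F) (a b c d : F) : (cmb x y a b c d).det =
    a ^ 2 + b ^ 2 + c ^ 2 + d ^ 2 + a * b * x.1.trace + a * c * y.1.trace + a * d * (x * y).1.trace
    + b * c * (x.1.trace * y.1.trace - (x * y).1.trace) + b * d * y.1.trace + c * d * x.1.trace := by
  have hx := sl_det x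
  have hy := sl_det y
  rw [cmb, Matrix.det_fin_two, mul_val]
  simp only [Matrix.trace_fin_two, mul_ap, Matrix.add_apply, Matrix.smul_apply, smul_eq_mul,
    one00, one01, one10, one11]
  generalize x.1 0 0 = x1 at *
  generalize x.1 0 1 = x2 at *
  generalize x.1 1 0 = x3 at *
  generalize x.1 1 1 = x4 at *
  generalize y.1 0 0 = y1 at *
  generalize y.1 0 1 = y2 at *
  generalize y.1 1 0 = y3 at *
  generalize y.1 1 1 = y4 at *
  linear_combination (b ^ 2 + d ^ 2 * (y1 * y4 - y2 * y3) + b * d * (y1 + y4)) * hx +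
    (c ^ 2 + d ^ 2 + c * d * (x1 + x4)) * hy

lemma tr_xx (x : SL2 F) : (x.1 * x.1).trace = x.1.trace ^ 2 - 2 := trace_mul_self x

lemma tr_xxy (x : SL2 F) (Y : M2 F) : (x.1 * (x.1 * Y)).trace = x.1.trace * (x.1 * Y).trace - Y.trace := by
  rw [← mul_assoc, sl_sq]; simp [sub_mul, Matrix.trace_sub, Matrix.trace_smul]

lemma cmb_tr (x y : SL2 F) (a b c d : F) : (cmb x y a b c d).trace =
    2 * a + b * x.1.trace + c * y.1.trace + d * (x * y).1.trace := by
  simp [cmb, Matrix.trace_add, Matrix.trace_smul, mul_val]; ring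

lemma cmb_trx (x y : SL2 F) (a b c d : F) : (x.1 * cmb x y a b c d).trace =
    a * x.1.trace + b * (x.1.trace ^ 2 - 2) + c * (x * y).1.trace
      + d * (x.1.trace * (x * y).1.trace - y.1.trace) := by
  simp [cmb, mul_add, Matrix.trace_add, Matrix.trace_smul, mul_val, tr_xx, tr_xxy]

lemma cmb_try (x y : SL2 F) (a b c d : F) : (y.1 * cmb x y a b c d).trace =
    a * y.1.trace + b * (x * y).1.trace + c * (y.1.trace ^ 2 - 2)
      + d * (y.1.trace * (x * y).1.trace - x.1.trace) := by
  have h1 : (y.1 * x.1).trace = (x.1 * y.1).trace := Matrix.trace_mul_comm _ _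
  have h2 : (y.1 * (x.1 * y.1)).trace = y.1.trace * (x.1 * y.1).trace - x.1.trace := by
    rw [Matrix.trace_mul_comm, mul_assoc, sl_sq]
    simp [mul_sub, Matrix.trace_sub, Matrix.trace_smul]
  simp [cmb, mul_add, Matrix.trace_add, Matrix.trace_smul, mul_val, tr_xx, h1, h2]

lemma anti_id (x c : SL2 F) : x.1 * tl c + tl c * x.1 =
    (2 * x.1.trace) • c.1 + (2 * ((x * c).1.trace - x.1.trace * c.1.trace)) • 1 := by
  rw [mul_val]
  apply m2_ext <;> simp only [tl, Matrix.trace_fin_two, mul_ap, Matrix.add_apply, Matrix.smul_apply,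
    Matrix.sub_apply, smul_eq_mul, one00, one01, one10, one11] <;> ring

lemma anti_iff (h2 : (2 : F) ≠ 0) {x c : SL2 F} (hc : NC c) :
    x.1 * tl c = -(tl c * x.1) ↔ x.1.trace = 0 ∧ (x * c).1.trace = 0 := by
  have h := anti_id x c
  rw [← add_eq_zero_iff_eq_neg, h]
  constructor
  · intro e
    have h0 : x.1.trace = 0 := by
      by_contra h0
      have h20 : 2 * x.1.trace ≠ 0 := mul_ne_zero h2 h0
      refine (nc_of_nonscalar.1 hc) (-((2 * ((x * c).1.trace - x.1.trace * c.1.trace)) / (2 * x.1.trace))) ?_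
      rw [neg_smul, div_eq_inv_mul, mul_smul, ← smul_neg, eq_inv_smul_iff₀ h20]
      exact eq_neg_of_add_eq_zero_left e
    refine ⟨h0, ?_⟩
    rw [h0] at e
    have := congrFun (congrFun e 0) 0
    simpa [h2] using this
  · rintro ⟨h0, h1⟩
    rw [h0, h1]; simp

end generic2

section steps
variable {p : ℕ} [hpF : Fact p.Prime]

lemma io_tl (x : SL2 (ZMod p)) : tl (io p x) = (tl x).map (algebraMap (ZMod p) (Kp p)) := by
  rw [tl, io_trace, io_val, tl]
  have e : algebraMap (ZMod p) (Kp p) 2 = 2 := map_ofNat _ 2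
  apply m2_ext <;> simp only [Matrix.sub_apply, Matrix.smul_apply, Matrix.map_apply, smul_eq_mul,
    one00, one01, one10, one11, map_sub, map_mul, map_one, map_zero, e]

lemma map_inj2 : Function.Injective
    (fun X : M2 (ZMod p) => X.map (algebraMap (ZMod p) (Kp p))) :=
  Matrix.map_injective (algebraMap (ZMod p) (Kp p)).injective

lemma B_axis (h5 : 5 < p) {H : Subgroup (SL2 (ZMod p))} {Z : M2 (Kp p)} (hZ : Z * Z = 1)
    (ht : Z.trace = 0) (hH : ∀ h ∈ H, CA (io p h).1 Z) {c : SL2 (ZMod p)} (hc : c ∈ H) (hn : NC c)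
    (h0 : c.1.trace ≠ 0) : ∀ h ∈ H, CA h.1 (tl c) := by
  have h2 := two_ne_K h5
  obtain ⟨k, hk⟩ : ∃ k, Z = k • tl (io p c) := by
    rcases hH c hc with e | e
    · exact Z_eq_smul_tl h2 (io_NC hn) ht e
    · exfalso
      apply h0
      have := trace_zero_of_anti h2 hZ e
      rw [io_trace] at this
      exact (map_eq_zero _).1 this
  have hk0 : k ≠ 0 := by
    rintro rfl
    exact ne_zero_of_sq hZ (by rw [hk]; simp)
  intro h hh
  have e := hH h hh
  rw [hk] at e
  unfold CA at e ⊢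
  rw [mul_smul_comm, smul_mul_assoc, ← smul_neg, smul_right_inj hk0, smul_right_inj hk0, io_tl,
    io_val, ← Matrix.map_mul, ← Matrix.map_mul] at e
  refine e.imp (fun e => map_inj2 e) (fun e => map_inj2 ?_)
  refine e.trans ?_
  ext i j
  simp only [Matrix.neg_apply, Matrix.map_apply, map_neg]

lemma cls (h5 : 5 < p) (hmod : p % 5 = 2 ∨ p % 5 = 3) {H : Subgroup (SL2 (ZMod p))} (hneg : -1 ∈ H)
    (ht : H ≠ ⊤) {c : SL2 (ZMod p)} (hc : c ∈ H) (hn : NC c) (h0 : c.1.trace ≠ 0) :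
    (∃ P, H ≤ Bor P) ∨ (∀ h ∈ H, CA h.1 (tl c)) ∨
    (∀ h ∈ H, NC h → h.1.trace ^ 2 = 0 ∨ h.1.trace ^ 2 = 1 ∨ h.1.trace ^ 2 = 2) := by
  rcases classify h5 hmod H hneg ht with ⟨P, hP, _⟩ | ⟨_, ⟨Z, hZ, hZt, hH⟩ | ⟨_, h⟩⟩
  · exact Or.inl ⟨P, hP⟩
  · exact Or.inr (Or.inl (B_axis h5 hZ hZt hH hc hn h0))
  · exact Or.inr (Or.inr h)

lemma NC_of_sq {x : SL2 (ZMod p)} (h : x.1.trace ^ 2 ≠ 4) : NC x := by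
  constructor
  · rintro rfl
    apply h; simp; norm_num
  · rintro rfl
    apply h; simp [neg_val]; norm_num

lemma num_ne {n : ℕ} (h : ∀ q, q.Prime → q ∣ n → q < p) : ((n : ℕ) : ZMod p) ≠ 0 := natCast_ne h

lemma exists_c (h11 : 11 < p) {x : SL2 (ZMod p)} (hx : ¬ IsSquare (x.1.trace ^ 2 - 4)) :
    ∃ c : SL2 (ZMod p), (∃ α β : ZMod p, β ≠ 0 ∧ c.1 = α • 1 + β • x.1 ∧
      c.1.trace ^ 2 - 4 = β ^ 2 * (x.1.trace ^ 2 - 4)) ∧ c.1.trace ≠ 0 ∧ c.1.trace ^ 2 ≠ 1 ∧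
      c.1.trace ^ 2 ≠ 2 := by
  have h5 : 5 < p := by omega
  have h2 := two_ne h5
  have h3 := three_ne h5
  set t := x.1.trace with ht
  set w := 4 - t ^ 2 with hw
  obtain ⟨A, hA⟩ : ∃ A : ZMod p,
      A * (A ^ 2 - w) * (A ^ 2 - 3 * w) * (3 * A ^ 2 - w) * (A ^ 4 - 6 * w * A ^ 2 + w ^ 2) ≠ 0 := by
    open Polynomial in
    have := Polynomial.exists_eval_ne_zero_of_natDegree_lt_card
      (X * (X ^ 2 - C w) * (X ^ 2 - C (3 * w)) * (C 3 * X ^ 2 - C w) *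
        (X ^ 4 - C (6 * w) * X ^ 2 + C (w ^ 2)) : (ZMod p)[X]) ?_ ?_
    · obtain ⟨A, hA⟩ := this
      refine ⟨A, ?_⟩
      simpa using hA
    · refine mul_ne_zero (mul_ne_zero (mul_ne_zero (mul_ne_zero ?_ ?_) ?_) ?_) ?_
      · exact X_ne_zero
      · exact (by monicity! : (X ^ 2 - C w : (ZMod p)[X]).Monic).ne_zero
      · exact (by monicity! : (X ^ 2 - C (3 * w) : (ZMod p)[X]).Monic).ne_zero
      · intro e
        have := congrArg (fun f => coeff f 2) e
        simp [coeff_C] at this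
        exact h3 this
      · exact (by monicity! : (X ^ 4 - C (6 * w) * X ^ 2 + C (w ^ 2) : (ZMod p)[X]).Monic).ne_zero
    · have hd : (X * (X ^ 2 - C w) * (X ^ 2 - C (3 * w)) * (C 3 * X ^ 2 - C w) *
        (X ^ 4 - C (6 * w) * X ^ 2 + C (w ^ 2)) : (ZMod p)[X]).natDegree ≤ 11 := by compute_degree
      rw [Cardinal.mk_fintype, ZMod.card]
      exact_mod_cast lt_of_le_of_lt hd h11
  simp only [mul_ne_zero_iff] at hA
  obtain ⟨⟨⟨⟨hA0, hA1⟩, hA2⟩, hA3⟩, hA4⟩ := hA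
  obtain ⟨s, hs⟩ : ∃ s, A = 2 * s + t := ⟨(A - t) / 2, by field_simp; ring⟩
  have hN : s ^ 2 + s * t + 1 ≠ 0 := by
    intro e
    apply hx
    refine ⟨A, ?_⟩
    rw [hs]; linear_combination -4 * e
  set N := s ^ 2 + s * t + 1 with hNd
  have hdet : ((N⁻¹ * (s ^ 2 - 1)) • 1 + (N⁻¹ * A) • x.1 : M2 (ZMod p)).det = 1 := by
    have hxd := sl_det x
    rw [Matrix.det_fin_two]
    have ht' : t = x.1 0 0 + x.1 1 1 := by rw [ht, Matrix.trace_fin_two]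
    simp only [mul_ap, Matrix.add_apply, Matrix.smul_apply, smul_eq_mul, one00, one01, one10, one11]
    have : N⁻¹ * N = 1 := inv_mul_cancel₀ hN
    have e : (s ^ 2 - 1) ^ 2 + (s ^ 2 - 1) * A * t + A ^ 2 = N ^ 2 := by rw [hs, hNd]; ring
    have e2 : N⁻¹ ^ 2 * N ^ 2 = 1 := by rw [← mul_pow, this, one_pow]
    rw [← e, ht'] at e2
    linear_combination e2 + N⁻¹ ^ 2 * A ^ 2 * hxd
  have htr : (((N⁻¹ * (s ^ 2 - 1)) • 1 + (N⁻¹ * A) • x.1 : M2 (ZMod p))).trace = 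
      2 * (A ^ 2 - w) / (4 * N) := by
    have h4 : (4 : ZMod p) ≠ 0 := by
      rw [show (4 : ZMod p) = 2 * 2 by norm_num]; exact mul_ne_zero h2 h2
    rw [Matrix.trace_add, Matrix.trace_smul, Matrix.trace_smul, ← ht]
    simp
    field_simp
    rw [hs, hw]; ring
  have h4N : 4 * N = A ^ 2 + w := by rw [hs, hw, hNd]; ring
  have h4N0 : 4 * N ≠ 0 := by
    rw [show (4 : ZMod p) = 2 * 2 by norm_num]; exact mul_ne_zero (mul_ne_zero h2 h2) hN
  have h4 : (4 : ZMod p) ≠ 0 := by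
    rw [show (4 : ZMod p) = 2 * 2 by norm_num]; exact mul_ne_zero h2 h2
  refine ⟨⟨_, hdet⟩, ⟨_, N⁻¹ * A, ?_, rfl, ?_⟩, ?_, ?_, ?_⟩
  · exact mul_ne_zero (inv_ne_zero hN) hA0
  · rw [htr, div_pow]
    field_simp
    rw [hw, hs]; rw [hNd]; ring
  · rw [htr]
    exact div_ne_zero (mul_ne_zero h2 hA1) h4N0
  · rw [htr, div_pow, Ne, div_eq_one_iff_eq (pow_ne_zero 2 h4N0), h4N]
    intro e
    exact mul_ne_zero hA2 hA3 (by linear_combination e)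
  · rw [htr, div_pow, Ne, div_eq_iff (pow_ne_zero 2 h4N0), h4N]
    intro e
    exact hA4 (mul_left_cancel₀ h2 (by linear_combination e))

lemma Bor_of_LL {a b P : SL2 (ZMod p)} (h : LL a b ≤ Bor P) : (a.1 * b.1 - b.1 * a.1).det = 0 :=
  Bor_comm (h (LL_l a b)) (h (LL_r a b))

lemma comm13a (h11 : 11 < p) (hmod : p % 5 = 2 ∨ p % 5 = 3) {x y : SL2 (ZMod p)}
    (hs : ∀ g, Sv x g → Sv y g) (hx : ¬ IsSquare (x.1.trace ^ 2 - 4)) :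
    x * y = y * x ∨ (y.1.trace = 0 ∧ (x * y).1.trace = 0) := by
  have h5 : 5 < p := by omega
  have h2 := two_ne h5
  obtain ⟨c, ⟨α, β, hβ, hc, hcx⟩, h0, h1, h22⟩ := exists_c h11 hx
  have hns : ¬ IsSquare (c.1.trace ^ 2 - 4) := by
    rintro ⟨d, hd⟩
    apply hx
    refine ⟨d / β, ?_⟩
    field_simp
    rw [← pow_two] at hd
    rw [← hd, hcx]; ring
  have h4 : c.1.trace ^ 2 ≠ 4 := by
    intro e; apply hns; rw [e]; exact ⟨0, by ring⟩
  have hxn : NC x := NC_of_sq (by intro e; apply hx; rw [e]; exact ⟨0, by ring⟩)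
  have hcom : c * x = x * c := by
    apply sl_ext; rw [mul_val, mul_val, hc]; simp [add_mul, mul_add]
  have hS : Sv y c := hs c (Sv_of_comm h5 hxn hcom)
  rcases cls h5 hmod (LL_n y c) hS (LL_r y c) (NC_of_sq h4) h0 with ⟨P, hP⟩ | h | h
  · exact absurd (Bor_disc (hP (LL_r y c))) hns
  · rcases h y (LL_l y c) with e | e
    · left
      rw [tl_comm_iff h2] at e
      have e' : y.1 * c.1 = c.1 * y.1 := congrArg Subtype.val e
      rw [hc] at e'
      simp only [mul_add, add_mul, mul_smul_comm, smul_mul_assoc, mul_one, one_mul,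
        add_right_inj, smul_right_inj hβ] at e'
      exact sl_ext e'.symm
    · right
      rw [anti_iff h2 (NC_of_sq h4)] at e
      refine ⟨e.1, ?_⟩
      have e' := e.2
      rw [mul_val, hc, mul_add, Matrix.trace_add, mul_smul_comm, mul_smul_comm, Matrix.trace_smul,
        Matrix.trace_smul, mul_one, e.1] at e'
      simp [hβ] at e'
      rw [mul_val, Matrix.trace_mul_comm, e']
  · exfalso
    rcases h c (LL_r y c) (NC_of_sq h4) with h | h | h
    · exact h0 (by simpa using h)
    · exact h1 h
    · exact h22 h

lemma anti13 (h11 : 11 < p) (hmod : p % 5 = 2 ∨ p % 5 = 3) {x y : SL2 (ZMod p)}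
    (hs : ∀ g, Sv x g → Sv y g) (hx : x.1.trace = 0) (hy : y.1.trace = 0)
    (hxy : (x * y).1.trace = 0) : False := by
  have h5 : 5 < p := by omega
  have h2 := two_ne h5
  have h3 := three_ne h5
  have h7 : (7 : ZMod p) ≠ 0 := by
    have := num_ne (p := p) (n := 7) (fun q hq hd => by
      have := Nat.le_of_dvd (by norm_num) hd; omega)
    exact_mod_cast this
  have h55 : (5 : ZMod p) ≠ 0 := by
    have := num_ne (p := p) (n := 5) (fun q hq hd => by
      have := Nat.le_of_dvd (by norm_num) hd; omega)
    exact_mod_cast this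
  let g : SL2 (ZMod p) := ⟨cmb x y (2/3) 0 (2/3) (1/3), by
    rw [cmb_det, hx, hy, hxy]; field_simp; norm_num⟩
  have hg : g.1 = cmb x y (2/3) 0 (2/3) (1/3) := rfl
  have hgt : g.1.trace = 4 / 3 := by rw [hg, cmb_tr, hx, hy, hxy]; field_simp; norm_num
  have hxg : (x * g).1.trace = 0 := by rw [mul_val, hg, cmb_trx, hx, hy, hxy]; ring
  have hyg : (y * g).1.trace = -4 / 3 := by rw [mul_val, hg, cmb_try, hx, hy, hxy]; field_simp; norm_num
  have hS : Sv y g := hs g (Sv_of_mul (Sv_of_trace_zero h5 hx hxg))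
  have h4 : (4 : ZMod p) ≠ 0 := by
    rw [show (4 : ZMod p) = 2 * 2 by norm_num]; exact mul_ne_zero h2 h2
  have hg4 : g.1.trace ^ 2 ≠ 4 := by
    rw [hgt]; intro e; field_simp at e
    exact h55 (by linear_combination -e)
  have hcm : y.1 * g.1 - g.1 * y.1 = (2/3 : ZMod p) • x.1 := by
    have exy := sq_of_trace_zero hxy
    have ey := sq_of_trace_zero hy
    have ex := sq_of_trace_zero hx
    rw [mul_val] at exy
    have h : y.1 * x.1 = - (x.1 * y.1) := by
      have : x.1 * (x.1 * y.1 * (x.1 * y.1)) * y.1 = (x.1 * x.1) * (y.1 * x.1) * (y.1 * y.1) := by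
        simp only [mul_assoc]
      rw [exy, ex, ey] at this
      simp at this
      rw [← this]
    rw [hg, cmb]
    simp only [mul_add, add_mul, mul_smul_comm, smul_mul_assoc, mul_one, one_mul, ← mul_assoc, h]
    rw [neg_mul, mul_assoc, ey]
    apply m2_ext <;> simp <;> ring
  have h23 : (2 / 3 : ZMod p) ≠ 0 := div_ne_zero h2 h3
  rcases cls h5 hmod (LL_n y g) hS (LL_r y g) (NC_of_sq hg4) (by rw [hgt]; exact div_ne_zero h4 h3)
    with ⟨P, hP⟩ | h | h
  · have := Bor_of_LL hP
    rw [hcm, Matrix.det_smul, x.2] at this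
    simp at this
    exact this.elim h2 h3
  · rcases h y (LL_l y g) with e | e
    · rw [tl_comm_iff h2] at e
      have e' : y.1 * g.1 = g.1 * y.1 := congrArg Subtype.val e
      rw [e', sub_self] at hcm
      have := congrArg Matrix.det hcm.symm
      rw [Matrix.det_smul, x.2] at this
      simp at this
      exact this.elim h2 h3
    · rw [anti_iff h2 (NC_of_sq hg4), hyg] at e
      exact div_ne_zero (neg_ne_zero.2 h4) h3 e.2
  · rcases h g (LL_r y g) (NC_of_sq hg4) with h | h | h <;> rw [hgt] at h <;> field_simp at h
    · exact mul_ne_zero h4 h4 (by linear_combination h)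
    · exact h7 (by linear_combination h)
    · exact h2 (by linear_combination -h)

end steps
end PSLsol


namespace PSLsol
open Matrix
set_option linter.unusedSectionVars false

section generic3
variable {F : Type*} [Field F]

lemma sum_id (x y : SL2 F) : x.1 * y.1 + y.1 * x.1 = x.1.trace • y.1 + y.1.trace • x.1
    + ((x * y).1.trace - x.1.trace * y.1.trace) • 1 := by
  rw [mul_val]
  apply m2_ext <;> simp only [Matrix.trace_fin_two, mul_ap, Matrix.add_apply, Matrix.smul_apply,
    Matrix.sub_apply, smul_eq_mul, one00, one01, one10, one11] <;> ring

lemma s4_key {a b : SL2 F} (ha : a.1.trace ^ 2 = 2) (hb : b.1.trace = 0)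
    (hab : (a * b).1.trace ^ 2 = 1) :
    a * (b * (a * a) * b⁻¹) * a = b * (a * a) * b⁻¹ := by
  have hbi : b⁻¹ = -b := by
    apply sl_ext; rw [inv_val', hb, neg_val]; simp
  have hj : (b * (a * a) * b⁻¹).1.trace = 0 := by
    rw [trace_conj, trace_mul_self, ha]; ring
  have haj : (a * (b * (a * a) * b⁻¹)).1.trace = 0 := by
    have e : (a * (b * (a * a) * b⁻¹)).1 =
        a.1.trace • (a * (b * a * b⁻¹)).1 - a.1 := by
      simp only [mul_val]
      rw [sl_sq]
      simp only [mul_sub, sub_mul, mul_smul_comm, smul_mul_assoc, mul_one, mul_inv_val]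
    have e2 : (a * (b * a * b⁻¹)).1 = -((a * b) * (a * b)).1 := by
      rw [hbi]
      simp [mul_assoc]
    rw [e, e2, Matrix.trace_sub, Matrix.trace_smul, Matrix.trace_neg, trace_mul_self, hab, smul_eq_mul]
    ring
  generalize b * (a * a) * b⁻¹ = j at *
  have e := sum_id a j
  rw [hj, haj] at e
  simp at e
  have e3 : a⁻¹ * j = j * a := by
    apply sl_ext
    rw [mul_val, mul_val, inv_val', sub_mul, smul_mul_assoc, one_mul, ← e]
    abel
  rw [mul_assoc, ← e3]; simp

end generic3

section seven

instance fact7 : Fact (Nat.Prime 7) := ⟨by norm_num⟩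

lemma Sv_s4 {a b : SL2 (ZMod 7)} (ha : a.1.trace ^ 2 = 2) (hb : b.1.trace = 0)
    (hab : (a * b).1.trace ^ 2 = 1) : Sv a b := by
  have hk := s4_key ha hb hab
  have hbi : b⁻¹ = -b := by
    apply sl_ext; rw [inv_val', hb, neg_val]; simp
  have hbb : b * b = -1 := sl_ext (sq_of_trace_zero hb)
  obtain ⟨i, hi⟩ : ∃ i, i = a * a := ⟨_, rfl⟩
  have hit : i.1.trace = 0 := by rw [hi, trace_mul_self, ha]; ring
  have hii : i * i = -1 := sl_ext (sq_of_trace_zero hit)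
  have hinv : i⁻¹ = -i := by
    apply sl_ext; rw [inv_val', hit, neg_val]; simp
  rw [← hi] at hk
  obtain ⟨j, hj⟩ : ∃ j, j = b * i * b⁻¹ := ⟨_, rfl⟩
  rw [← hj] at hk
  have hji : j * i = -(i * j) := by
    have : i * j * i = j := by
      rw [hi]
      calc a * a * j * (a * a) = a * (a * j * a) * a := by simp only [mul_assoc]
        _ = j := by rw [hk, hk]
    have h2 := congrArg (fun z => i⁻¹ * z) this
    simp only [mul_assoc, inv_mul_cancel_left] at h2
    rw [h2, hinv]; simp
  have A1 : a * i * a⁻¹ = i := by rw [hi]; simp [mul_assoc]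
  have A1' : a⁻¹ * i * a = i := by rw [hi]; simp
  have A2 : a * j * a⁻¹ = i * j := by
    rw [mul_inv_eq_iff_eq_mul, hi]
    calc a * j = a * (a * j * a) := by rw [hk]
      _ = _ := by simp only [mul_assoc]
  have A2' : a⁻¹ * j * a = -(i * j) := by
    have : a⁻¹ * j * a = i⁻¹ * j := by
      rw [hi]
      calc a⁻¹ * j * a = a⁻¹ * a⁻¹ * (a * j * a) := by simp [mul_assoc]
        _ = _ := by rw [hk]; simp
    rw [this, hinv]; simp
  have A3 : a * (i * j) * a⁻¹ = -j := by
    calc a * (i * j) * a⁻¹ = (a * i * a⁻¹) * (a * j * a⁻¹) := by simp [mul_assoc]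
      _ = (i * i) * j := by rw [A1, A2, mul_assoc]
      _ = -j := by rw [hii]; simp
  have A3' : a⁻¹ * (i * j) * a = j := by
    calc a⁻¹ * (i * j) * a = (a⁻¹ * i * a) * (a⁻¹ * j * a) := by simp [mul_assoc]
      _ = -((i * i) * j) := by rw [A1', A2', mul_neg, mul_assoc]
      _ = j := by rw [hii]; simp
  have B1 : b * i * b⁻¹ = j := hj.symm
  have B2 : b * j * b⁻¹ = i := by
    rw [hj, hbi]
    calc b * (b * i * -b) * -b = (b * b) * i * (b * b) := by simp [mul_assoc]
      _ = i := by rw [hbb]; simp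
  have B3 : b * (i * j) * b⁻¹ = -(i * j) := by
    calc b * (i * j) * b⁻¹ = (b * i * b⁻¹) * (b * j * b⁻¹) := by simp [mul_assoc]
      _ = _ := by rw [B1, B2, hji]
  have C1 : b⁻¹ * i * b = j := by rw [← B1, hbi]; simp
  have C2 : b⁻¹ * j * b = i := by rw [← B2, hbi]; simp [mul_assoc]
  have C3 : b⁻¹ * (i * j) * b = -(i * j) := by rw [← B3, hbi]; simp [mul_assoc]
  let S : Finset (SL2 (ZMod 7)) := {i, -i, j, -j, i * j, -(i * j)}
  have key : ∀ h ∈ LL a b, (∀ s ∈ S, h * s * h⁻¹ ∈ S) ∧ (∀ s ∈ S, h⁻¹ * s * h ∈ S) := by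
    intro h hh
    induction hh using Subgroup.closure_induction with
    | mem z hz =>
      rcases hz with rfl | rfl | rfl
      · constructor <;> simp [S, A1, A1', A2, A2', A3, A3']
      · constructor <;> simp [S, B1, B2, B3, C1, C2, C3]
      · constructor <;> simp
    | one => simp
    | mul u v _ _ hu hv =>
      constructor
      · intro s hs
        have := hu.1 _ (hv.1 s hs)
        simpa [mul_assoc] using this
      · intro s hs
        have := hv.2 _ (hu.2 s hs)
        simpa [mul_assoc] using this
    | inv u _ hu =>
      rw [inv_inv]
      exact ⟨hu.2, hu.1⟩
  intro htop
  have key2 : ∀ h : SL2 (ZMod 7), h * i * h⁻¹ ∈ S := fun h =>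
    (key h (by rw [LL, htop]; trivial)).1 i (by simp [S])
  obtain ⟨s, -, t, -, hst, e⟩ := Finset.exists_ne_map_eq_of_card_lt_of_maps_to
    (s := (Finset.univ : Finset (ZMod 7))) (t := S) (f := fun t => E12 t * i * (E12 t)⁻¹)
    (lt_of_le_of_lt Finset.card_le_six (by simp)) (fun t _ => key2 _)
  have e1 : E12 s * i * (E12 s)⁻¹ * (E12 t) = E12 t * i := by
    rw [e]; simp [mul_assoc]
  have e2 := congrArg Subtype.val e1
  simp only [mul_val, inv_val, E12, mk_val, m2_ext_iff, mul_ap] at e2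
  simp at e2
  have h00 := e2.1
  have hd := sl_det i
  rw [Matrix.trace_fin_two] at hit
  have h10 : i.1 1 0 = 0 := h00.resolve_left hst
  rw [h10, show i.1 1 1 = - i.1 0 0 by linear_combination hit, mul_zero, sub_zero] at hd
  generalize i.1 0 0 = z at hd
  revert hd; revert z; decide

end seven

lemma unip_one {p : ℕ} [hpF : Fact p.Prime] {x g : SL2 (ZMod p)} (hS : Sv x g)
    (hx : ¬ IsSquare (x.1.trace ^ 2 - 4)) (h : (x * g).1.trace = 2) : x * g = 1 := by
  by_contra hne
  obtain ⟨P, l, hl, e⟩ := unip_conj h hne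
  by_cases ht : (x * g * x).1.trace = x.1.trace
  · exact hx (Bor_disc ((mem_Bor_iff hl e x).2 ht))
  · exact hS (top_of_unip ((LL x g).mul_mem (LL_l _ _) (LL_r _ _)) h hne (LL_l x g) ht)

section seven

lemma wit0 {x y : SL2 (ZMod 7)} (hs : ∀ g, Sv x g → Sv y g) (hx : x.1.trace = 0)
    (hy : y.1.trace = 0) (e a b c d : ZMod 7) (he : (x * y).1.trace = e)
    (h : a ^ 2 + b ^ 2 + c ^ 2 + d ^ 2 + a * d * e - b * c * e = 1 ∧ (2 * a + d * e) ^ 2 = 2 ∧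
      (-2 * b + c * e) ^ 2 = 1 ∧ b * e - 2 * c = 2) : False := by
  obtain ⟨h1, h2, h3, h4⟩ := h
  let g : SL2 (ZMod 7) := ⟨cmb x y a b c d, by
    rw [cmb_det, hx, hy, he]; linear_combination h1⟩
  have hg : g.1 = cmb x y a b c d := rfl
  have hgt : g.1.trace ^ 2 = 2 := by rw [hg, cmb_tr, hx, hy, he]; linear_combination h2
  have hxg : (g * x).1.trace ^ 2 = 1 := by
    rw [mul_val, Matrix.trace_mul_comm, hg, cmb_trx, hx, hy, he]; linear_combination h3
  have hyg : (y * g).1.trace = 2 := by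
    rw [mul_val, hg, cmb_try, hx, hy, he]; linear_combination h4
  have h1 := unip_one (hs g (Sv_comm.1 (Sv_s4 hgt hx hxg))) (by rw [hy]; decide) hyg
  have : g.1.trace = y.1.trace := by rw [← trace_inv y, eq_inv_of_mul_eq_one_right h1]
  rw [this, hy] at hgt
  revert hgt; decide

lemma wit3 {x y : SL2 (ZMod 7)} (hs : ∀ g, Sv x g → Sv y g) (hx : x.1.trace = 3)
    (hy : y.1.trace = 3) (e a b c d : ZMod 7) (he : (x * y).1.trace = e)
    (h : a ^ 2 + b ^ 2 + c ^ 2 + d ^ 2 + a * b * 3 + a * c * 3 + a * d * e + b * c * (9 - e) + b * d * 3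
        + c * d * 3 = 1 ∧ 2 * a + 3 * b + 3 * c + d * e = 0 ∧
      (3 * a + 7 * b + c * e + d * (3 * e - 3)) ^ 2 = 1 ∧
      3 * a + b * e + 7 * c + d * (3 * e - 3) = 2) : False := by
  obtain ⟨h1, h2, h3, h4⟩ := h
  let g : SL2 (ZMod 7) := ⟨cmb x y a b c d, by
    rw [cmb_det, hx, hy, he]; linear_combination h1⟩
  have hg : g.1 = cmb x y a b c d := rfl
  have hgt : g.1.trace = 0 := by rw [hg, cmb_tr, hx, hy, he]; linear_combination h2
  have hxg : (x * g).1.trace ^ 2 = 1 := by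
    rw [mul_val, hg, cmb_trx, hx, hy, he]; linear_combination h3
  have hyg : (y * g).1.trace = 2 := by
    rw [mul_val, hg, cmb_try, hx, hy, he]; linear_combination h4
  have h1 := unip_one (hs g (Sv_s4 (by rw [hx]; decide) hgt hxg)) (by rw [hy]; decide) hyg
  have : g.1.trace = y.1.trace := by rw [← trace_inv y, eq_inv_of_mul_eq_one_right h1]
  rw [this, hy] at hgt
  revert hgt; decide

lemma comm_of_mul_one {G : Type*} [Group G] {x y : G} (h : x * y = 1) : x * y = y * x := by
  rw [eq_inv_of_mul_eq_one_right h]; simp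

lemma all7 (e : ZMod 7) : e = 0 ∨ e = 1 ∨ e = 2 ∨ e = 3 ∨ e = 4 ∨ e = 5 ∨ e = 6 := by
  revert e; decide

lemma comm7_0 {x y : SL2 (ZMod 7)} (hs : ∀ g, Sv x g → Sv y g) (hx : x.1.trace = 0)
    (hy : y.1.trace = 0) : x * y = y * x := by
  have hxy : Sv x y := Sv_of_trace_zero (by norm_num) hx hy
  rcases all7 (x * y).1.trace with e | e | e | e | e | e | e
  · exact (wit0 hs hx hy _ 2 3 6 1 e (by decide)).elim
  · exact (wit0 hs hx hy _ 1 0 6 2 e (by decide)).elim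
  · exact comm_of_mul_one (unip_one hxy (by rw [hx]; decide) e)
  · exact (wit0 hs hx hy _ 1 3 0 5 e (by decide)).elim
  · exact (wit0 hs hx hy _ 1 4 0 2 e (by decide)).elim
  · have := comm_of_mul_one (unip_one (x := -x) (Sv_neg_l.2 hxy) (by
      rw [neg_val, Matrix.trace_neg, hx]; decide) (by
      rw [neg_mul, neg_val, Matrix.trace_neg, e]; decide))
    simpa using this
  · exact (wit0 hs hx hy _ 1 0 6 5 e (by decide)).elim

lemma comm7_3 {x y : SL2 (ZMod 7)} (hs : ∀ g, Sv x g → Sv y g) (hx : x.1.trace = 3)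
    (hy : y.1.trace = 3) : x * y = y * x := by
  have hxn : NC x := NC_of_sq (by rw [hx]; decide)
  have hxy : Sv x y := Sv_comm.1 (hs x (Sv_of_comm (by norm_num) hxn rfl))
  have hxy' : Sv x y⁻¹ := Sv_of_sub (LL_n x y) hxy (LL_l _ _) ((LL x y).inv_mem (LL_r _ _))
  rcases all7 (x * y).1.trace with e | e | e | e | e | e | e
  · have := comm_of_mul_one (unip_one hxy' (by rw [hx]; decide) (by
      rw [mul_val, inv_val', mul_sub, Matrix.trace_sub, ← mul_val, e, hy, mul_smul_comm,
        Matrix.trace_smul, mul_one, hx]; decide))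
    have h2 := congrArg (fun z => y * z * y) this
    simpa [mul_assoc] using h2.symm
  · exact (wit3 hs hx hy _ 2 3 0 1 e (by decide)).elim
  · exact comm_of_mul_one (unip_one hxy (by rw [hx]; decide) e)
  · exact (wit3 hs hx hy _ 4 5 0 4 e (by decide)).elim
  · exact (wit3 hs hx hy _ 1 4 2 2 e (by decide)).elim
  · exact (wit3 hs hx hy _ 0 4 2 2 e (by decide)).elim
  · exact (wit3 hs hx hy _ 3 4 0 4 e (by decide)).elim

lemma nonsq7 (t : ZMod 7) (h : ¬ IsSquare (t ^ 2 - 4)) : t = 0 ∨ t = 3 ∨ -t = 3 := by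
  revert t; decide

lemma comm7 {x y : SL2 (ZMod 7)} (hs : ∀ g, Sv x g → Sv y g)
    (hx : ¬ IsSquare (x.1.trace ^ 2 - 4)) (hy : ¬ IsSquare (y.1.trace ^ 2 - 4))
    (h0 : x.1.trace = 0 ↔ y.1.trace = 0) : x * y = y * x := by
  have h3 : ∀ {x' y' : SL2 (ZMod 7)}, (∀ g, Sv x' g → Sv y' g) → x'.1.trace = 3 →
      (y'.1.trace = 3 ∨ -y'.1.trace = 3) → x' * y' = y' * x' := by
    intro x' y' hs hx hy
    rcases hy with hy | hy
    · exact comm7_3 hs hx hy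
    · have := comm7_3 (x := x') (y := -y') (fun g hg => Sv_neg_l.2 (hs g hg)) hx (by
        rw [neg_val, Matrix.trace_neg, hy])
      simpa using this
  rcases nonsq7 _ hx with h | h | h
  · exact comm7_0 hs h (h0.1 h)
  · refine h3 hs h ((nonsq7 _ hy).resolve_left fun e => ?_)
    rw [h0.2 e] at h; revert h; decide
  · have := h3 (x' := -x) (fun g hg => hs g (Sv_neg_l.1 hg)) (by
      rw [neg_val, Matrix.trace_neg, h]) ((nonsq7 _ hy).resolve_left fun e => by
        rw [h0.2 e] at h; revert h; decide)
    simpa using this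

end seven

/-- Third step, second part -/
lemma comm_all {p : ℕ} [hpF : Fact p.Prime] (h5 : 5 < p) (hmod : p % 5 = 2 ∨ p % 5 = 3)
    {x y : SL2 (ZMod p)} (hs : ∀ g, Sv x g ↔ Sv y g)
    (hx4 : x.1.trace ^ 2 ≠ 4) (hy4 : y.1.trace ^ 2 ≠ 4)
    (h0 : x.1.trace = 0 ↔ y.1.trace = 0) : x * y = y * x := by
  by_cases hx : IsSquare (x.1.trace ^ 2 - 4)
  · exact split_comm h5 (fun g => (hs g).1) hx4 hx
  by_cases hy : IsSquare (y.1.trace ^ 2 - 4)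
  · exact (split_comm h5 (fun g => (hs g).2) hy4 hy).symm
  by_cases h7 : p = 7
  · subst h7
    exact comm7 (fun g => (hs g).1) hx hy h0
  · have h11 : 11 < p := by
      by_contra hlt
      have : p = 6 ∨ p = 7 ∨ p = 8 ∨ p = 9 ∨ p = 10 ∨ p = 11 := by omega
      rcases this with rfl | rfl | rfl | rfl | rfl | rfl
      · omega
      · exact h7 rfl
      · exact absurd hpF.out (by norm_num)
      · omega
      · omega
      · omega
    rcases comm13a h11 hmod (fun g => (hs g).1) hx with h | ⟨h1, h2⟩
    · exact h
    · exact (anti13 h11 hmod (fun g => (hs g).1) (h0.2 h1) h1 h2).elim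

end PSLsol


namespace PSLsol
open Matrix
set_option linter.unusedSectionVars false

lemma seven_b (b : ZMod 7) : 3 * b ^ 2 ≠ 4 := by revert b; decide

section steps
variable {p : ℕ} [hpF : Fact p.Prime]

lemma comb_of_comm {x y : SL2 (ZMod p)} (hx : NC x) (hy : NC y) (h : x * y = y * x) :
    ∃ α β : ZMod p, β ≠ 0 ∧ y.1 = α • 1 + β • x.1 := by
  obtain ⟨α, β, e⟩ := comm_comb (nc_of_nonscalar.1 hx) (congrArg Subtype.val h.symm)
  refine ⟨α, β, ?_, e⟩
  rintro rfl
  exact nc_of_nonscalar.1 hy α (by rw [e]; simp)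

lemma comb_trace {x y : SL2 (ZMod p)} {α β : ZMod p} (h : y.1 = α • 1 + β • x.1) :
    y.1.trace = 2 * α + β * x.1.trace := by
  rw [h, Matrix.trace_add, Matrix.trace_smul, Matrix.trace_smul]; simp; ring

lemma comb_norm {x y : SL2 (ZMod p)} {α β : ZMod p} (h : y.1 = α • 1 + β • x.1) :
    α ^ 2 + α * β * x.1.trace + β ^ 2 = 1 := by
  have hx := sl_det x
  have hy := sl_det y
  rw [h] at hy
  rw [Matrix.trace_fin_two]
  simp only [mul_ap, Matrix.add_apply, Matrix.smul_apply, smul_eq_mul, one00, one01, one10, one11] at hy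
  linear_combination hy - β ^ 2 * hx

lemma comb_disc {x y : SL2 (ZMod p)} {α β : ZMod p} (h : y.1 = α • 1 + β • x.1) :
    y.1.trace ^ 2 - 4 = β ^ 2 * (x.1.trace ^ 2 - 4) := by
  rw [comb_trace h]; linear_combination 4 * comb_norm h

lemma comb_tl {x y : SL2 (ZMod p)} {α β : ZMod p} (h : y.1 = α • 1 + β • x.1) :
    tl y = β • tl x := by
  rw [tl, tl, comb_trace h, h]
  apply m2_ext <;> simp <;> ring

lemma comb_CA {x y m : SL2 (ZMod p)} {α β : ZMod p} (hβ : β ≠ 0) (h : y.1 = α • 1 + β • x.1) :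
    CA m.1 (tl y) ↔ CA m.1 (tl x) := by
  rw [comb_tl h]; unfold CA
  rw [mul_smul_comm, smul_mul_assoc, ← smul_neg, smul_right_inj hβ, smul_right_inj hβ]

lemma eq_pm (h5 : 5 < p) {x y : SL2 (ZMod p)} (hx : NC x) (hy : NC y) (h : x * y = y * x)
    (hx4 : x.1.trace ^ 2 ≠ 4) (he : y.1.trace ^ 2 = x.1.trace ^ 2) :
    y = x ∨ y = -x ∨ y = x⁻¹ ∨ y = -x⁻¹ := by
  have h2 := two_ne h5
  obtain ⟨α, β, hβ, e⟩ := comb_of_comm hx hy h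
  have hd := comb_disc e
  have ht := comb_trace e
  have hb : β = 1 ∨ β = -1 := by
    have : (β ^ 2 - 1) * (x.1.trace ^ 2 - 4) = 0 := by linear_combination he - hd
    have := (mul_eq_zero.1 this).resolve_right (sub_ne_zero.2 hx4)
    have : (β - 1) * (β + 1) = 0 := by linear_combination this
    rcases mul_eq_zero.1 this with e | e
    · left; linear_combination e
    · right; linear_combination e
  have ht2 : y.1.trace = x.1.trace ∨ y.1.trace = -x.1.trace := sq_eq_sq_iff_eq_or_eq_neg.1 he
  rcases hb with rfl | rfl <;> rcases ht2 with hh | hh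
  · left
    have : α = 0 := mul_left_cancel₀ h2 (by linear_combination hh - ht)
    apply sl_ext; rw [e, this]; simp
  · right; right; right
    have : α = -x.1.trace := mul_left_cancel₀ h2 (by linear_combination hh - ht)
    apply sl_ext; rw [e, this, neg_val, inv_val']; simp; abel
  · right; right; left
    have : α = x.1.trace := mul_left_cancel₀ h2 (by linear_combination hh - ht)
    apply sl_ext; rw [e, this, inv_val']; simp; abel
  · right; left
    have : α = 0 := mul_left_cancel₀ h2 (by linear_combination hh - ht)
    apply sl_ext; rw [e, this, neg_val]; simp

lemma commutator_trace {x m : SL2 (ZMod p)} (h : (x.1 * m.1 - m.1 * x.1).det = 0) :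
    (x * m * (m * x)⁻¹).1.trace = 2 := by
  set W := (x.1 * m.1 - m.1 * x.1) * ((m * x)⁻¹).1 with hW
  have e : (x * m * (m * x)⁻¹).1 = 1 + W := by
    rw [hW, sub_mul, ← mul_val m x, mul_inv_val, mul_val, mul_val]; abel
  have hWd : W.det = 0 := by rw [hW, Matrix.det_mul, h, zero_mul]
  have hd : (1 + W).det = 1 := by rw [← e]; exact (x * m * (m * x)⁻¹).2
  rw [e, Matrix.trace_add]
  rw [Matrix.det_fin_two] at hd hWd
  rw [Matrix.trace_fin_two W]
  simp at hd ⊢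
  linear_combination hd - hWd

def Good (t : ZMod p) : Prop := t ^ 2 = 0 ∨ t ^ 2 = 1 ∨ t ^ 2 = 2

lemma arith (h5 : 5 < p) (hmod : p % 5 = 2 ∨ p % 5 = 3) {A B C S b : ZMod p}
    (hb : 3 * b ^ 2 = 4)
    (hA : A = 0 ∨ A = 1 ∨ A = 2) (hB : B = 0 ∨ B = 1 ∨ B = 2) (hC : C = 0 ∨ C = 1 ∨ C = 2)
    (hS : S = 0 ∨ S = 1 ∨ S = 2) (e1 : (A + B - C) ^ 2 - 4 * A * B = 0)
    (e2 : 3 * S - (2 * B - A + 2 * C) = 0) : A = 0 ∧ B = 0 := by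
  by_cases h7 : p = 7
  · exfalso
    subst h7
    exact seven_b b hb
  · have h840 : (840 : ZMod p) ≠ 0 := by
      have := num_ne (p := p) (n := 840) (fun q hq hd => by
        have : (840 : ℕ) = 8 * (3 * (5 * 7)) := by norm_num
        rw [this, hq.dvd_mul, hq.dvd_mul, hq.dvd_mul] at hd
        have : q ≤ 8 := by
          rcases hd with h | h | h | h <;> have := Nat.le_of_dvd (by norm_num) h <;> omega
        have hpp := hpF.out
        by_contra hlt
        have : p = 6 ∨ p = 8 := by omega
        rcases this with rfl | rfl <;> exact absurd hpp (by norm_num))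
      exact_mod_cast this
    rcases hA with rfl | rfl | rfl <;> rcases hB with rfl | rfl | rfl <;>
      rcases hC with rfl | rfl | rfl <;> first
      | exact ⟨rfl, rfl⟩
      | (exfalso; apply h840; first
          | linear_combination 840 * e1
          | linear_combination 210 * e1
          | linear_combination (-280) * e1
          | linear_combination (-210) * e1
          | linear_combination (-120) * e1
          | linear_combination (-70) * e1
          | (rcases hS with rfl | rfl | rfl <;> first
              | linear_combination 840 * e2
              | linear_combination (-840) * e2
              | linear_combination 420 * e2
              | linear_combination (-420) * e2
              | linear_combination 210 * e2
              | linear_combination (-210) * e2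
              | linear_combination 168 * e2
              | linear_combination (-168) * e2
              | linear_combination 105 * e2
              | linear_combination (-105) * e2))

lemma diff (h5 : 5 < p) (hmod : p % 5 = 2 ∨ p % 5 = 3) {X Y m : SL2 (ZMod p)} (hX : NC X) (hY : NC Y)
    (hc : X * Y = Y * X) (hX1 : X.1.trace ^ 2 = 1) (hY2 : Y.1.trace ^ 2 = 2)
    (h0 : Good m.1.trace) (h1 : Good (X * m).1.trace) (h2 : Good (X * (X * m)).1.trace)
    (h3 : Good (Y * (Y * m)).1.trace) : m.1.trace = 0 ∧ (m * X).1.trace = 0 := by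
  have h2' := two_ne h5
  set W := Y * Y with hW
  have hWt : W.1.trace = 0 := by rw [hW, trace_mul_self, hY2]; ring
  have hXW : X * W = W * X := by
    rw [hW, ← mul_assoc, hc, mul_assoc, hc, mul_assoc]
  obtain ⟨a, b, hb, e⟩ := comb_of_comm hX (NC_of_trace_zero h5 hWt) hXW
  have ht := comb_trace e
  have hd := comb_disc e
  rw [hWt] at ht hd
  rw [hX1] at hd
  have hb3 : 3 * b ^ 2 = 4 := by linear_combination hd
  have eS : (Y * (Y * m)).1.trace = a * m.1.trace + b * (X * m).1.trace := by
    rw [← mul_assoc, ← hW, mul_val, e, add_mul, Matrix.trace_add, smul_mul_assoc, smul_mul_assoc,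
      Matrix.trace_smul, Matrix.trace_smul, one_mul, mul_val]; simp
  have eC : (X * (X * m)).1.trace = X.1.trace * (X * m).1.trace - m.1.trace := by
    rw [mul_val, mul_val, tr_xxy]
  rw [eS] at h3
  rw [eC] at h2
  rw [mul_val m X, Matrix.trace_mul_comm, ← mul_val]
  generalize (X * m).1.trace = T1 at *
  generalize m.1.trace = T0 at *
  generalize X.1.trace = τ at *
  have hCC : T0 ^ 2 + T1 ^ 2 - (τ * T1 - T0) ^ 2 = 2 * τ * T0 * T1 := by
    linear_combination (-T1 ^ 2) * hX1
  have h4 : (2 : ZMod p) * 2 ≠ 0 := mul_ne_zero h2' h2'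
  have hSS : 3 * (a * T0 + b * T1) ^ 2 - (2 * T1 ^ 2 - T0 ^ 2 + 2 * (τ * T1 - T0) ^ 2) = 0 := by
    refine (mul_eq_zero.1 ?_).resolve_left h4
    linear_combination (-3 * T0 * (2 * a * T0 + 4 * b * T1 - b * τ * T0)) * ht
      + (2 * T1 - τ * T0) ^ 2 * hb3 + (4 * T0 ^ 2 - 8 * T1 ^ 2) * hX1
  have := arith h5 hmod hb3 h0 h1 h2 h3 (by
    rw [hCC]; linear_combination (4 * T0 ^ 2 * T1 ^ 2) * hX1) hSS
  exact ⟨by simpa using this.1, by simpa using this.2⟩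

lemma not_comm_NC {x m k : SL2 (ZMod p)} (h : m * x ≠ x * m) (hk : k * x = x * k) : NC (k * m) := by
  constructor
  · intro e
    apply h
    rw [eq_inv_of_mul_eq_one_right e]
    rw [inv_mul_eq_iff_eq_mul, ← mul_assoc, hk, mul_inv_cancel_right]
  · intro e
    apply h
    have e' : k * (-m) = 1 := by rw [mul_neg, e, neg_neg]
    have : -m * x = x * -m := by
      rw [eq_inv_of_mul_eq_one_right e']
      rw [inv_mul_eq_iff_eq_mul, ← mul_assoc, hk, mul_inv_cancel_right]
    simpa using this

lemma stepC (h5 : 5 < p) (hmod : p % 5 = 2 ∨ p % 5 = 3) {x y : SL2 (ZMod p)}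
    (hx4 : x.1.trace ^ 2 ≠ 4) (hy4 : y.1.trace ^ 2 ≠ 4) (hx0 : x.1.trace ≠ 0) (hy0 : y.1.trace ≠ 0)
    (hc : x * y = y * x) {M : Subgroup (SL2 (ZMod p))} (hneg : -1 ∈ M) (hxM : x ∈ M)
    (hss : ∀ h ∈ M, h.1.trace ^ 2 = 4 → h = 1 ∨ h = -1) (hMC : ∀ h ∈ M, NC h → Good h.1.trace)
    {m : SL2 (ZMod p)} (hm : m ∈ M) (hmx : ¬ CA m.1 (tl x)) (hS : Sv y m) : y ∈ M := by
  have h2 := two_ne h5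
  have hxn := NC_of_sq hx4
  have hyn := NC_of_sq hy4
  obtain ⟨α, β, hβ, e⟩ := comb_of_comm hxn hyn hc
  have hmc : m * x ≠ x * m := fun h => hmx (Or.inl ((tl_comm_iff h2 x m).2 h))
  have hmc' : m * y ≠ y * m := fun h => hmx ((comb_CA hβ e).1 (Or.inl ((tl_comm_iff h2 y m).2 h)))
  rcases cls h5 hmod (LL_n y m) hS (LL_l y m) hyn hy0 with ⟨P, hP⟩ | h | h
  · exfalso
    have hdet := Bor_of_LL hP
    have e1 : y.1 * m.1 - m.1 * y.1 = β • (x.1 * m.1 - m.1 * x.1) := by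
      rw [e]; simp only [add_mul, mul_add, smul_mul_assoc, mul_smul_comm, one_mul, mul_one, smul_sub]
      abel
    rw [e1, Matrix.det_smul] at hdet
    have hdet' := (mul_eq_zero.1 hdet).resolve_left (pow_ne_zero _ hβ)
    have htr := commutator_trace hdet'
    rcases hss _ (M.mul_mem (M.mul_mem hxM hm) (M.inv_mem (M.mul_mem hm hxM)))
      (by rw [htr]; norm_num) with h | h
    · exact hmc (mul_inv_eq_one.1 h).symm
    · rw [h] at htr
      have h4 : (2 : ZMod p) * 2 = 0 := by
        simp [neg_val] at htr
        linear_combination -htr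
      exact mul_ne_zero h2 h2 h4
  · exact absurd ((comb_CA hβ e).1 (h m (LL_r y m))) hmx
  · have gx : Good x.1.trace := hMC x hxM hxn
    have gy : Good y.1.trace := h y (LL_l y m) hyn
    have gx' := gx.resolve_left (pow_ne_zero 2 hx0)
    have gy' := gy.resolve_left (pow_ne_zero 2 hy0)
    have heq : y.1.trace ^ 2 = x.1.trace ^ 2 → y ∈ M := by
      intro he
      rcases eq_pm h5 hxn hyn hc hx4 he with rfl | rfl | rfl | rfl
      · exact hxM
      · exact neg_mem_of hneg hxM
      · exact M.inv_mem hxM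
      · exact neg_mem_of hneg (M.inv_mem hxM)
    have nx1 : NC (1 * m) := not_comm_NC hmc (by simp)
    have nx2 : NC (x * m) := not_comm_NC hmc rfl
    have nx3 : NC (x * (x * m)) := by rw [← mul_assoc]; exact not_comm_NC hmc (by simp [mul_assoc])
    have ny2 : NC (y * m) := not_comm_NC hmc' rfl
    have ny3 : NC (y * (y * m)) := by rw [← mul_assoc]; exact not_comm_NC hmc' (by simp [mul_assoc])
    rw [one_mul] at nx1
    have hLm := LL_r y m
    have hLy := LL_l y m
    rcases gx' with gx' | gx' <;> rcases gy' with gy' | gy'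
    · exact heq (by rw [gx', gy'])
    · exfalso
      have := diff h5 hmod hxn hyn hc gx' gy' (hMC m hm nx1) (hMC _ (M.mul_mem hxM hm) nx2)
        (hMC _ (M.mul_mem hxM (M.mul_mem hxM hm)) nx3)
        (h _ ((LL y m).mul_mem hLy ((LL y m).mul_mem hLy hLm)) ny3)
      exact hmx (Or.inr ((anti_iff h2 hxn).2 this))
    · exfalso
      have := diff h5 hmod hyn hxn hc.symm gy' gx' (hMC m hm nx1) (h _ ((LL y m).mul_mem hLy hLm) ny2)
        (h _ ((LL y m).mul_mem hLy ((LL y m).mul_mem hLy hLm)) ny3)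
        (hMC _ (M.mul_mem hxM (M.mul_mem hxM hm)) nx3)
      exact hmx ((comb_CA hβ e).1 (Or.inr ((anti_iff h2 hyn).2 this)))
    · exact heq (by rw [gx', gy'])

lemma scalar_of (h5 : 5 < p) {x y : SL2 (ZMod p)} (hs : ∀ g, Sv x g → Sv y g) (hx : ¬ NC x) :
    ¬ NC y := by
  have hxc : ∀ g, x * g = g * x := by
    intro g
    have : x = 1 ∨ x = -1 := by unfold NC at hx; tauto
    rcases this with rfl | rfl <;> simp
  have key : ∀ u : SL2 (ZMod p), u.1.trace = 2 → u ≠ 1 → (u * y).1.trace = y.1.trace := by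
    intro u hu hu1
    apply (Sv_unip hu hu1 y).1
    apply hs
    apply Sv_comm.1
    refine Sv_of_comm h5 ⟨hu1, ?_⟩ (hxc u)
    rintro rfl
    have h2 := two_ne h5
    have h4 : (2 : ZMod p) * 2 = 0 := by
      simp [neg_val] at hu
      linear_combination -hu
    exact mul_ne_zero h2 h2 h4
  have k1 := key (E12 1) (by simp [E12, Matrix.trace_fin_two]; norm_num) (by
    intro e; have := congrArg (fun g : SL2 (ZMod p) => g.1 0 1) e; simp [E12] at this)
  have k2 := key (E21 1) (by simp [E21, Matrix.trace_fin_two]; norm_num) (by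
    intro e; have := congrArg (fun g : SL2 (ZMod p) => g.1 1 0) e; simp [E21] at this)
  have k3 := key (mk 2 (-1) 1 0 (by ring)) (by simp [Matrix.trace_fin_two]) (by
    intro e; have := congrArg (fun g : SL2 (ZMod p) => g.1 1 0) e; simp at this)
  rw [mul_val, Matrix.trace_fin_two, mul_ap, mul_ap, Matrix.trace_fin_two] at k1 k2 k3
  simp [E12, E21] at k1 k2 k3
  rw [nc_of_nonscalar]
  intro h
  apply h (y.1 0 0)
  apply m2_ext <;> simp <;> grind

theorem half (h5 : 5 < p) (hmod : p % 5 = 2 ∨ p % 5 = 3) {x y : SL2 (ZMod p)}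
    (hs : ∀ g, Sv x g ↔ Sv y g) {M : Subgroup (SL2 (ZMod p))} (hM : IsCoatom M) (hneg : -1 ∈ M)
    (hxM : x ∈ M) : y ∈ M := by
  have h2 := two_ne h5
  rcases classify h5 hmod M hneg hM.1 with ⟨P, hP, u, huM, hut, hu1, hu⟩ | ⟨hss, hBC⟩
  · have e := (hM.le_iff_eq (Bor_ne_top P)).1 hP
    rw [← e, hu]
    exact (Sv_unip hut hu1 y).1 ((hs u).1 (Sv_of_sub hneg hM.1 hxM huM))
  by_cases hyn : NC y
  swap
  · have : y = 1 ∨ y = -1 := by unfold NC at hyn; tauto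
    rcases this with rfl | rfl
    · exact M.one_mem
    · exact hneg
  have hxn : NC x := by
    by_contra h
    exact scalar_of h5 (fun g => (hs g).1) h hyn
  have hx4 : x.1.trace ^ 2 ≠ 4 := by
    intro e
    rcases hss x hxM e with h | h
    · exact hxn.1 h
    · exact hxn.2 h
  have hSm : ∀ m ∈ M, Sv y m := fun m hm => (hs m).1 (Sv_of_sub hneg hM.1 hxM hm)
  have hunip : ∀ u : SL2 (ZMod p), u.1.trace = 2 → u ≠ 1 → (∀ m ∈ M, Sv u m) → u ∈ M := by
    intro u hut hu1 h
    obtain ⟨P, l, hl, e⟩ := unip_conj hut hu1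
    have hle : M ≤ Bor P := fun m hm =>
      (mem_Bor_iff hl e m).2 ((Sv_unip hut hu1 m).1 (Sv_comm.1 (h m hm)))
    rw [← (hM.le_iff_eq (Bor_ne_top P)).1 hle, mem_Bor_iff hl e, trace_mul_self, hut]
    ring
  by_cases hy4 : y.1.trace ^ 2 = 4
  · rcases trace_two_or hy4 with h | h
    · exact hunip y h hyn.1 hSm
    · rw [← neg_mem_iff' hneg]
      refine hunip (-y) (by rw [neg_val, Matrix.trace_neg, h, neg_neg]) ?_
        (fun m hm => Sv_neg_l.2 (hSm m hm))
      intro e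
      exact hyn.2 (by rw [← e, neg_neg])
  have h0 : x.1.trace = 0 ↔ y.1.trace = 0 :=
    ⟨trace_zero_of h5 (fun g => (hs g).1) hy4, trace_zero_of h5 (fun g => (hs g).2) hx4⟩
  have hc := comm_all h5 hmod hs hx4 hy4 h0
  by_cases hx0 : x.1.trace = 0
  · rcases eq_pm h5 hxn hyn hc hx4 (by rw [hx0, h0.1 hx0]) with rfl | rfl | rfl | rfl
    · exact hxM
    · exact neg_mem_of hneg hxM
    · exact M.inv_mem hxM
    · exact neg_mem_of hneg (M.inv_mem hxM)
  have hy0 : y.1.trace ≠ 0 := fun h => hx0 (h0.2 h)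
  by_cases hall : ∀ h ∈ M, CA h.1 (tl x)
  · have hle : M ≤ NZ (tl x) := hall
    rw [← (hM.le_iff_eq (NZ_ne_top h2 (tl_ne h2 hxn) (tl_trace x))).1 hle]
    exact Or.inl ((tl_comm_iff h2 x y).2 hc.symm)
  · rcases hBC with ⟨Z, hZ, hZt, hH⟩ | ⟨-, hC⟩
    · exact absurd (B_axis h5 hZ hZt hH hxM hxn hx0) hall
    · push Not at hall
      obtain ⟨m, hm, hmx⟩ := hall
      exact stepC h5 hmod hx4 hy4 hx0 hy0 hc hneg hxM hss hC hm hmx (hSm m hm)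

end steps
end PSLsol

/-- Let `p > 5` be a prime with `p ≡ 2` or `3 (mod 5)` and `G = PSL(2, p)`.
If `x, y ∈ G` have equal solvabilizers, then `x` and `y` lie in exactly the same
maximal subgroups of `G`. -/
theorem mem_same_maximal_subgroups_PSL_p
    (p : ℕ) (hp : p.Prime) (hp5 : 5 < p) (hmod : p % 5 = 2 ∨ p % 5 = 3)
    (x y : PSL 2 (ZMod p))
    (h : solvabilizer x = solvabilizer y) :
    ∀ M : Subgroup (PSL 2 (ZMod p)), IsCoatom M → (x ∈ M ↔ y ∈ M) := by
  haveI : Fact p.Prime := ⟨hp⟩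
  intro M hM
  obtain ⟨a, rfl⟩ := QuotientGroup.mk_surjective x
  obtain ⟨b, rfl⟩ := QuotientGroup.mk_surjective y
  have hs : ∀ g, PSLsol.Sv a g ↔ PSLsol.Sv b g := by
    intro g
    rw [← PSLsol.Sv_iff hp5 hmod, ← PSLsol.Sv_iff hp5 hmod]
    have := congrArg (fun S => (QuotientGroup.mk g : PSL 2 (ZMod p)) ∈ S) h
    exact this.to_iff
  let π := QuotientGroup.mk' (Subgroup.center (Matrix.SpecialLinearGroup (Fin 2) (ZMod p)))
  have hco : IsCoatom (M.comap π) :=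
    Subgroup.isCoatom_comap_of_surjective (QuotientGroup.mk'_surjective _) hM
  have hneg : -1 ∈ M.comap π := by
    have : π (-1) = 1 := (QuotientGroup.eq_one_iff _).2 PSLsol.neg_one_center
    rw [Subgroup.mem_comap, this]
    exact M.one_mem
  exact ⟨fun hx => PSLsol.half hp5 hmod hs hco hneg hx,
    fun hy => PSLsol.half hp5 hmod (fun g => (hs g).symm) hco hneg hy⟩
end

section
/- Let n ≥ 2 be an integer, q = 2^n, and G = PSL(2, q). Then every solvable subgroup H of G is contained in a subgroup K of G such that K is isomorphic to the dihedral group of order 2(q−1), or K is isomorphic to the dihedral group of order 2(q+1), or K is isomorphic to a semidirect product of an elementary abelian group (Z/2Z)^n of order q by a cyclic group of order q−1 (i.e., there exists an action φ of Z/(q−1)Z on (Z/2Z)^n with K ≅ (Z/2Z)^n ⋊_φ Z/(q−1)Z). -/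
open Matrix

/-- The three types of overgroups. -/
def GoodType {G : Type*} [Group G] (n : ℕ) (K : Subgroup G) : Prop :=
  Nonempty (↥K ≃* DihedralGroup (2 ^ n - 1)) ∨
       Nonempty (↥K ≃* DihedralGroup (2 ^ n + 1)) ∨
       ∃ φ : Multiplicative (ZMod (2 ^ n - 1)) →* MulAut (Fin n → Multiplicative (ZMod 2)),
         Nonempty (↥K ≃* SemidirectProduct (Fin n → Multiplicative (ZMod 2))
           (Multiplicative (ZMod (2 ^ n - 1))) φ)

/-- Being contained in an overgroup of good type. -/
def Good {G : Type*} [Group G] (n : ℕ) (H : Subgroup G) : Prop :=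
  ∃ K : Subgroup G, H ≤ K ∧ GoodType n K

theorem GoodType.congr {G G' : Type*} [Group G] [Group G'] {n : ℕ} {K : Subgroup G}
    {K' : Subgroup G'} (e : K ≃* K') (h : GoodType n K') : GoodType n K := by
  rcases h with ⟨⟨f⟩⟩ | ⟨⟨f⟩⟩ | ⟨φ, ⟨f⟩⟩
  · exact Or.inl ⟨e.trans f⟩
  · exact Or.inr (Or.inl ⟨e.trans f⟩)
  · exact Or.inr (Or.inr ⟨φ, ⟨e.trans f⟩⟩)

theorem Good.of_map {G G' : Type*} [Group G] [Group G'] {n : ℕ} {H : Subgroup G}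
    (e : G ≃* G') (h : Good n (H.map (e : G →* G'))) : Good n H := by
  obtain ⟨K, hK, hg⟩ := h
  refine ⟨K.map (e.symm : G' →* G), ?_, hg.congr (e.symm.subgroupMap K).symm⟩
  intro x hx
  exact ⟨e x, hK ⟨x, hx, rfl⟩, by simp⟩

theorem exists_commuting {G : Type*} [Group G] (H : Subgroup G) (hs : IsSolvable H)
    (hne : H ≠ ⊥) : ∃ g ∈ H, g ≠ 1 ∧ ∀ h ∈ H, Commute (h * g * h⁻¹) g := by
  classical
  have hex := hs.solvable
  have hn := Nat.find_spec hex
  rcases hk : Nat.find hex with _ | k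
  · rw [hk, derivedSeries_zero] at hn
    exfalso
    apply hne
    rw [eq_bot_iff]
    intro x hx
    have : (⟨x, hx⟩ : H) ∈ (⊤ : Subgroup H) := trivial
    rw [hn, Subgroup.mem_bot] at this
    simpa using congrArg Subtype.val this
  · have hk' : derivedSeries H k ≠ ⊥ := Nat.find_min hex (by omega)
    rw [hk, derivedSeries_succ, Subgroup.commutator_eq_bot_iff_le_centralizer] at hn
    obtain ⟨g, hg, hg1⟩ := Subgroup.ne_bot_iff_exists_ne_one.1 hk' |>.elim
      fun a ha => (⟨a.1, a.2, fun h => ha (Subtype.ext h)⟩ : ∃ g ∈ derivedSeries H k, g ≠ 1)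
    refine ⟨g, g.2, fun h => hg1 (Subtype.ext h), fun h hh => ?_⟩
    have h1 := (derivedSeries_normal H k).conj_mem g hg ⟨h, hh⟩
    have h2 := hn h1
    rw [Subgroup.mem_centralizer_iff] at h2
    have h3 := congrArg Subtype.val (h2 g hg)
    exact h3.symm

/-- Abstract recognition of a dihedral group. -/
theorem dihedral_recog {G : Type*} [Group G] (C : Subgroup G) [hc : IsCyclic C] (m : ℕ)
    (hm : Nat.card C = m) (w : G) (hw : w * w = 1) (hwC : w ∉ C)
    (hinv : ∀ c ∈ C, w * c * w = c⁻¹) :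
    ∃ K : Subgroup G, C ≤ K ∧ w ∈ K ∧ Nonempty (K ≃* DihedralGroup m) := by
  subst hm
  let f : Multiplicative (ZMod (Nat.card C)) ≃* C := zmodCyclicMulEquiv hc
  let p : ZMod (Nat.card C) → G := fun i => (f (Multiplicative.ofAdd i) : G)
  have padd : ∀ i j, p (i + j) = p i * p j := fun i j => by simp [p, ofAdd_add]
  have psub : ∀ i j, p (i - j) = p i * (p j)⁻¹ := fun i j => by
    simp [p, ofAdd_sub, div_eq_mul_inv]
  have pmem : ∀ i, p i ∈ C := fun i => (f _).2
  have pinv : ∀ i, w * p i * w = (p i)⁻¹ := fun i => hinv _ (pmem i)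
  have pcomm : ∀ i j, p i * p j = p j * p i := fun i j => by
    rw [← padd, ← padd, add_comm]
  have pinv' : ∀ i, p i * w = w * (p i)⁻¹ := fun i => by
    rw [← pinv, ← mul_assoc, ← mul_assoc, hw, one_mul]
  have p0 : p 0 = 1 := by simp [p]
  have pinj : ∀ i, p i = 1 → i = 0 := by
    intro i hi
    have : f (Multiplicative.ofAdd i) = 1 := Subtype.ext hi
    simpa using this
  let F : DihedralGroup (Nat.card C) →* G :=
    MonoidHom.mk' (fun x => match x with
      | .r i => p i
      | .sr i => w * p i) (by
      rintro (i | i) (j | j)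
      · simp [padd]
      · simp only [DihedralGroup.r_mul_sr, psub]
        rw [← mul_assoc (p i), pinv', mul_assoc w, ← one_mul ((p i)⁻¹), ← p0, ← psub, ← padd,
          ← padd, add_comm]
      · simp [padd, mul_assoc]
      · simp only [DihedralGroup.sr_mul_sr, psub]
        rw [mul_assoc w, ← mul_assoc (p i), pinv', ← mul_assoc, ← mul_assoc, hw, one_mul]
        rw [← psub, ← one_mul ((p i)⁻¹), ← p0, ← psub, ← padd]; congr 1; ring)
  have hF : Function.Injective F := by
    rw [injective_iff_map_eq_one]
    rintro (i | i) h
    · rw [pinj i h]; rfl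
    · exfalso
      apply hwC
      have h' : w * p i = 1 := h
      rw [eq_inv_of_mul_eq_one_left h']
      exact C.inv_mem (pmem i)
  refine ⟨F.range, ?_, ?_, ⟨(MonoidHom.ofInjective hF).symm⟩⟩
  · intro c hcc
    refine ⟨.r (Multiplicative.toAdd (f.symm ⟨c, hcc⟩)), ?_⟩
    change p _ = c
    simp [p]
  · refine ⟨.sr 0, ?_⟩
    change w * p 0 = w
    rw [p0, mul_one]

section SLTwo
set_option linter.unusedSectionVars false
variable {F : Type*} [Field F] [CharP F 2]

local notation "SLF" => Matrix.SpecialLinearGroup (Fin 2) F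

theorem sl_ext {x y : SLF} (h00 : x 0 0 = y 0 0) (h01 : x 0 1 = y 0 1) (h10 : x 1 0 = y 1 0)
    (h11 : x 1 1 = y 1 1) : x = y := by
  ext i j
  fin_cases i <;> fin_cases j <;> assumption

theorem sl_mul (x y : SLF) (i j : Fin 2) : (x * y) i j = x i 0 * y 0 j + x i 1 * y 1 j := by
  simp [Matrix.mul_apply, Fin.sum_univ_two]

theorem sl_det (x : SLF) : x 0 0 * x 1 1 - x 0 1 * x 1 0 = 1 := by
  rw [← Matrix.det_fin_two]; exact x.2

/-- An element of `SL₂` from its entries. -/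
def mkSL (a b c d : F) (h : a * d - b * c = 1) : SLF :=
  ⟨!![a, b; c, d], by simp [Matrix.det_fin_two, h]⟩

@[simp] theorem mkSL_00 (a b c d : F) (h) : mkSL a b c d h 0 0 = a := rfl
@[simp] theorem mkSL_01 (a b c d : F) (h) : mkSL a b c d h 0 1 = b := rfl
@[simp] theorem mkSL_10 (a b c d : F) (h) : mkSL a b c d h 1 0 = c := rfl
@[simp] theorem mkSL_11 (a b c d : F) (h) : mkSL a b c d h 1 1 = d := rfl
@[simp] theorem sl_one_00 : (1 : SLF) 0 0 = 1 := by simp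
@[simp] theorem sl_one_01 : (1 : SLF) 0 1 = 0 := by simp
@[simp] theorem sl_one_10 : (1 : SLF) 1 0 = 0 := by simp
@[simp] theorem sl_one_11 : (1 : SLF) 1 1 = 1 := by simp

theorem two0 : (2 : F) = 0 := CharTwo.two_eq_zero

theorem sq_one {a : F} (h : a * a = 1) : a = 1 := by
  have : (a - 1) * (a - 1) = 0 := by linear_combination h + (1 - a) * two0 (F := F)
  exact sub_eq_zero.1 (mul_self_eq_zero.1 this)

theorem center_SL : Subgroup.center SLF = ⊥ := by
  rw [eq_bot_iff]
  intro A hA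
  obtain ⟨r, hr, hA⟩ := Matrix.SpecialLinearGroup.mem_center_iff.1 hA
  have : r = 1 := sq_one (by simpa [pow_two] using hr)
  subst this
  rw [Subgroup.mem_bot]
  apply Subtype.ext
  rw [← hA]; simp

/-- The companion matrix of trace `t`. -/
def compMat (t : F) : SLF := mkSL 0 1 1 t (by linear_combination (-1 : F) * two0 (F := F))

theorem exists_conj_cmp [Finite F] (g : SLF) (hg : g ≠ 1) :
    ∃ P : SLF, P * g * P⁻¹ = compMat (g 0 0 + g 1 1) := by
  have hd := sl_det g
  have key : ∃ u v : F, u * (u * g 0 1 + v * g 1 1) - v * (u * g 0 0 + v * g 1 0) ≠ 0 := by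
    by_contra! hcon
    have h1 : g 0 1 = 0 := by simpa using hcon 1 0
    have h2 : g 1 0 = 0 := by simpa using hcon 0 1
    have h3 : g 1 1 = g 0 0 := by
      have := hcon 1 1
      rw [h1, h2] at this
      linear_combination this
    have h4 : g 0 0 = 1 := sq_one (by rw [h1, h3] at hd; linear_combination hd)
    exact hg (sl_ext (by simp [h4]) (by simp [h1]) (by simp [h2]) (by simp [h3, h4]))
  obtain ⟨u, v, hQ⟩ := key
  obtain ⟨r, hr⟩ := FiniteField.isSquare_of_char_two (ringChar.eq F 2)
    (u * (u * g 0 1 + v * g 1 1) - v * (u * g 0 0 + v * g 1 0))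
  have hr0 : r ≠ 0 := by rintro rfl; apply hQ; rw [hr]; ring
  refine ⟨mkSL (u / r) (v / r) ((u * g 0 0 + v * g 1 0) / r) ((u * g 0 1 + v * g 1 1) / r) ?_, ?_⟩
  · field_simp
    linear_combination hr
  · rw [mul_inv_eq_iff_eq_mul]
    apply sl_ext <;> simp only [sl_mul, compMat, mkSL_00, mkSL_01, mkSL_10, mkSL_11] <;> field_simp
    · ring
    · ring
    · linear_combination (-u) * hd - u * two0 (F := F)
    · linear_combination (-v) * hd - v * two0 (F := F)

theorem mem_cent {t : F} {x : SLF} :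
    x ∈ Subgroup.centralizer {compMat t} ↔ x 1 0 = x 0 1 ∧ x 1 1 = x 0 0 + t * x 0 1 := by
  rw [Subgroup.mem_centralizer_singleton_iff]
  constructor
  · intro h
    have h1 := congrArg (fun z : SLF => z 0 0) h
    have h2 := congrArg (fun z : SLF => z 0 1) h
    simp only [sl_mul, compMat, mkSL_00, mkSL_01, mkSL_10, mkSL_11] at h1 h2
    constructor
    · first | linear_combination h1 | linear_combination -h1
    · first | linear_combination h2 | linear_combination -h2
  · rintro ⟨h1, h2⟩
    apply sl_ext <;> simp only [sl_mul, compMat, mkSL_00, mkSL_01, mkSL_10, mkSL_11, h1, h2] <;> ring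

/-- The swap involution. -/
def swapMat : SLF := mkSL 0 1 1 0 (by linear_combination (-1 : F) * two0 (F := F))

theorem swap_sq : (swapMat : SLF) * swapMat = 1 := by
  apply sl_ext <;> simp [sl_mul, swapMat]

theorem swap_inv {t : F} {c : SLF} (hc : c ∈ Subgroup.centralizer {compMat t}) :
    swapMat * c * swapMat = c⁻¹ := by
  obtain ⟨h1, h2⟩ := mem_cent.1 hc
  have hd := sl_det c
  apply eq_inv_of_mul_eq_one_left
  rw [h1, h2] at hd
  apply sl_ext <;> simp only [sl_mul, swapMat, mkSL_00, mkSL_01, mkSL_10, mkSL_11, h1, h2,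
    sl_one_00, sl_one_01, sl_one_10, sl_one_11]
  · linear_combination hd + c 0 1 * c 0 1 * two0 (F := F)
  · linear_combination (c 0 1 * (c 0 0 + t * c 0 1)) * two0 (F := F)
  · linear_combination (c 0 1 * c 0 0) * two0 (F := F)
  · linear_combination hd + c 0 1 * c 0 1 * two0 (F := F)

theorem swap_not_mem {t : F} (ht : t ≠ 0) :
    (swapMat : SLF) ∉ Subgroup.centralizer {compMat t} := by
  intro h
  have := (mem_cent.1 h).2
  simp [swapMat] at this
  exact ht this.symm

theorem sl_trace_conj (h g : SLF) :
    (h * g * h⁻¹) 0 0 + (h * g * h⁻¹) 1 1 = g 0 0 + g 1 1 := by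
  rw [← Matrix.trace_fin_two, ← Matrix.trace_fin_two, Matrix.SpecialLinearGroup.coe_mul,
    Matrix.trace_mul_comm, ← Matrix.SpecialLinearGroup.coe_mul]
  rw [show h⁻¹ * (h * g) = g from inv_mul_cancel_left h g]

theorem mem_of_commute {t : F} (ht : t ≠ 0) {h : SLF}
    (hh : Commute (h * compMat t * h⁻¹) (compMat t)) :
    h ∈ Subgroup.centralizer {compMat t} ∨ swapMat * h ∈ Subgroup.centralizer {compMat t} := by
  set y := h * compMat t * h⁻¹ with hy
  have hyC : y ∈ Subgroup.centralizer {compMat t} :=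
    Subgroup.mem_centralizer_singleton_iff.2 hh
  obtain ⟨h1, h2⟩ := mem_cent.1 hyC
  have htr : y 0 0 + y 1 1 = t := by
    rw [hy, sl_trace_conj]; simp [compMat]
  have hd := sl_det y
  rw [h2] at htr
  have hb : y 0 1 = 1 := by
    apply mul_left_cancel₀ ht
    linear_combination htr - y 0 0 * two0 (F := F)
  rw [h1, h2, hb] at hd
  have ha : y 0 0 * (y 0 0 + t) = 0 := by
    linear_combination hd + two0 (F := F)
  rcases mul_eq_zero.1 ha with ha | ha
  · left
    have : y = compMat t := by
      apply sl_ext <;> simp [compMat, h1, h2, hb, ha]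
    rw [Subgroup.mem_centralizer_singleton_iff]
    rw [hy, mul_inv_eq_iff_eq_mul] at this
    exact this
  · right
    have : swapMat * y * swapMat = compMat t := by
      apply sl_ext <;> simp [compMat, swapMat, sl_mul, h1, h2, hb, ha]
      linear_combination ha - t * two0 (F := F)
    rw [Subgroup.mem_centralizer_singleton_iff]
    calc swapMat * h * compMat t = swapMat * y * (swapMat * swapMat) * h := by
          rw [swap_sq, hy]; group
      _ = (swapMat * y * swapMat) * (swapMat * h) := by group
      _ = _ := by rw [this]

/-- Evaluation of the torus at an eigenvalue. -/
noncomputable def evalHom {E : Type*} [Field E] [Algebra F E] (t : F) (θ : E)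
    (hθ : θ * θ = algebraMap F E t * θ + 1) :
    (Subgroup.centralizer {compMat t} : Subgroup SLF) →* E where
  toFun x := algebraMap F E (x.1 0 0) + algebraMap F E (x.1 0 1) * θ
  map_one' := by simp
  map_mul' x y := by
    obtain ⟨h1, h2⟩ := mem_cent.1 y.2
    simp only [Subgroup.coe_mul, sl_mul, h1, h2, map_add, map_mul]
    linear_combination (-(algebraMap F E (x.1 0 1) * algebraMap F E (y.1 0 1))) * hθ

theorem evalHom_inj {E : Type*} [Field E] [Algebra F E] {t : F} (ht : t ≠ 0) (θ : E)
    (hθ : θ * θ = algebraMap F E t * θ + 1) : Function.Injective (evalHom t θ hθ) := by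
  rw [injective_iff_map_eq_one]
  intro x hx
  obtain ⟨h1, h2⟩ := mem_cent.1 x.2
  have hd := sl_det x.1
  have h20 : (2 : E) = 0 := by
    rw [← map_ofNat (algebraMap F E) 2, two0, map_zero]
  have ht' : algebraMap F E t ≠ 0 := by simpa using ht
  rw [h1, h2] at hd
  have hd' := congrArg (algebraMap F E) hd
  simp only [map_sub, map_mul, map_add, map_one] at hd'
  change algebraMap F E (x.1 0 0) + algebraMap F E (x.1 0 1) * θ = 1 at hx
  set a := algebraMap F E (x.1 0 0) with hadef
  set b := algebraMap F E (x.1 0 1) with hbdef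
  set T := algebraMap F E t
  have e1 : a + b * (T + θ) = 1 := by
    have : (a + b * θ) * (a + b * (T + θ)) = 1 := by
      linear_combination hd' + b * b * hθ + (a * b * θ + b * b * T * θ + b * b) * h20
    rw [hx] at this
    linear_combination this
  have hb : b = 0 := by
    apply mul_left_cancel₀ ht'
    linear_combination e1 - hx
  have ha : a = 1 := by rw [hb] at hx; linear_combination hx
  have hb' : x.1 0 1 = 0 := by simpa [hbdef] using hb
  have ha' : x.1 0 0 = 1 := by
    apply (algebraMap F E).injective; rw [map_one]; exact ha
  apply Subtype.ext
  apply sl_ext <;> simp [h1, h2, hb', ha']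

theorem cent_cyclic [Finite F] {t : F} (ht : t ≠ 0) :
    IsCyclic (Subgroup.centralizer {compMat t} : Subgroup SLF) := by
  obtain ⟨θ, hθ⟩ := IsAlgClosed.exists_root
    (Polynomial.X ^ 2 - Polynomial.C (algebraMap F (AlgebraicClosure F) t) * Polynomial.X
      - Polynomial.C 1 : Polynomial (AlgebraicClosure F)) (by
        have : (Polynomial.X ^ 2 - Polynomial.C (algebraMap F (AlgebraicClosure F) t) * Polynomial.X
          - Polynomial.C 1 : Polynomial (AlgebraicClosure F)).degree = 2 := by compute_degree!
        rw [this]; norm_num)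
  have hθ' : θ * θ = algebraMap F (AlgebraicClosure F) t * θ + 1 := by
    simp [Polynomial.IsRoot] at hθ
    linear_combination hθ
  exact isCyclic_of_subgroup_isDomain (evalHom t θ hθ') (evalHom_inj ht θ hθ')

theorem cent_card_split [Finite F] {t : F} (ht : t ≠ 0) (l : F) (hl : l * l = t * l + 1) :
    Nat.card (Subgroup.centralizer {compMat t} : Subgroup SLF) = Nat.card F - 1 := by
  rw [← Nat.card_units]
  apply Nat.card_congr
  apply Equiv.ofBijective (evalHom (E := F) t l (by simpa using hl)).toHomUnits
  constructor
  · intro x y hxy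
    apply evalHom_inj ht l (by simpa using hl)
    simpa using congrArg Units.val hxy
  · intro m
    have hm : (m : F) ≠ 0 := m.ne_zero
    -- b t = m + m⁻¹
    let b : F := (m + (m : F)⁻¹) / t
    let a : F := m - b * l
    have hb : b * t = m + (m : F)⁻¹ := by simp only [b]; field_simp
    have hmm : (m : F) * (m : F)⁻¹ = 1 := mul_inv_cancel₀ hm
    have hdet : a * (a + t * b) - b * b = 1 := by
      have e : a + t * b = (m : F)⁻¹ - b * l + m * 2 := by simp only [a]; linear_combination hb
      rw [two0 (F := F), mul_zero, add_zero] at e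
      rw [e]
      simp only [a]
      linear_combination hmm + b * b * hl + (b * l) * hb
    refine ⟨⟨mkSL a b b (a + t * b) hdet, mem_cent.2 (by simp)⟩, ?_⟩
    apply Units.ext
    simp [evalHom, a]

theorem cent_card_nonsplit [Finite F] {t : F} (hl : ∀ l : F, l * l ≠ t * l + 1) :
    Nat.card (Subgroup.centralizer {compMat t} : Subgroup SLF) = Nat.card F + 1 := by
  classical
  rw [← Finite.card_option]
  apply Nat.card_congr
  apply Equiv.ofBijective (fun x : (Subgroup.centralizer {compMat t} : Subgroup SLF) =>
    if x.1 0 1 = 0 then none else some (x.1 0 0 / x.1 0 1))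
  constructor
  · intro x y hxy
    obtain ⟨h1, h2⟩ := mem_cent.1 x.2
    obtain ⟨h3, h4⟩ := mem_cent.1 y.2
    have hd := sl_det x.1
    have hd' := sl_det y.1
    rw [h1, h2] at hd
    rw [h3, h4] at hd'
    have fin : x.1 0 0 = y.1 0 0 → x.1 0 1 = y.1 0 1 → x = y := fun e1 e2 => Subtype.ext
      (sl_ext e1 e2 (by rw [h1, h3, e2]) (by rw [h2, h4, e1, e2]))
    by_cases hx : x.1 0 1 = 0 <;> by_cases hy : y.1 0 1 = 0 <;> simp [hx, hy] at hxy
    · rw [hx] at hd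
      rw [hy] at hd'
      apply fin _ (by rw [hx, hy])
      rw [sq_one (a := x.1 0 0) (by linear_combination hd),
        sq_one (a := y.1 0 0) (by linear_combination hd')]
    · have ha : x.1 0 0 = (y.1 0 0 / y.1 0 1) * x.1 0 1 := by rw [← hxy]; field_simp
      have ha' : y.1 0 0 = (y.1 0 0 / y.1 0 1) * y.1 0 1 := by field_simp
      set s := y.1 0 0 / y.1 0 1
      have hb : x.1 0 1 = y.1 0 1 := by
        have hq : x.1 0 1 / y.1 0 1 = 1 := by
          apply sq_one
          rw [ha] at hd
          rw [ha'] at hd'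
          have hN : s * s + t * s - 1 ≠ 0 := by
            intro h0
            have : x.1 0 1 * x.1 0 1 * (s * s + t * s - 1) = 1 := by linear_combination hd
            rw [h0] at this
            simp at this
          have : x.1 0 1 * x.1 0 1 = y.1 0 1 * y.1 0 1 := by
            apply mul_right_cancel₀ hN
            linear_combination hd - hd'
          field_simp
          linear_combination this
        rwa [div_eq_one_iff_eq hy] at hq
      exact fin (by rw [ha, hb, ← ha']) hb
  · rintro (_ | s)
    · exact ⟨1, by simp⟩
    · have hN : s * s + t * s - 1 ≠ 0 := by
        intro h0
        apply hl s
        linear_combination h0 - t * s * two0 (F := F)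
      obtain ⟨r, hr⟩ := FiniteField.isSquare_of_char_two (ringChar.eq F 2) (s * s + t * s - 1)
      have hr0 : r ≠ 0 := by rintro rfl; apply hN; rw [hr]; ring
      refine ⟨⟨mkSL (s / r) (1 / r) (1 / r) (s / r + t * (1 / r)) ?_, mem_cent.2 (by simp)⟩, ?_⟩
      · field_simp
        linear_combination hr
      · simp [hr0]

theorem torus_good [Finite F] {n : ℕ} (hq : Nat.card F = 2 ^ n) {t : F} (ht : t ≠ 0)
    (H : Subgroup SLF) (hH : ∀ h ∈ H, Commute (h * compMat t * h⁻¹) (compMat t)) : Good n H := by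
  have hc := cent_cyclic ht
  have main : ∀ m, Nat.card (Subgroup.centralizer {compMat t} : Subgroup SLF) = m →
      ∃ K : Subgroup SLF, H ≤ K ∧ Nonempty (K ≃* DihedralGroup m) := by
    intro m hm
    obtain ⟨K, h1, h2, h3⟩ := dihedral_recog (Subgroup.centralizer {compMat t} : Subgroup SLF) m hm
      swapMat swap_sq (swap_not_mem ht) (fun c hc => swap_inv hc)
    refine ⟨K, fun h hh => ?_, h3⟩
    rcases mem_of_commute ht (hH h hh) with h4 | h4
    · exact h1 h4
    · have := K.mul_mem h2 (h1 h4)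
      rwa [← mul_assoc, swap_sq, one_mul] at this
  by_cases hl : ∃ l : F, l * l = t * l + 1
  · obtain ⟨l, hl⟩ := hl
    obtain ⟨K, h1, h2⟩ := main _ ((cent_card_split ht l hl).trans (by rw [hq]))
    exact ⟨K, h1, Or.inl h2⟩
  · push Not at hl
    obtain ⟨K, h1, h2⟩ := main _ ((cent_card_nonsplit hl).trans (by rw [hq]))
    exact ⟨K, h1, Or.inr (Or.inl h2)⟩

/-- The unipotent element. -/
def uniMat : SLF := mkSL 1 1 0 1 (by ring)

theorem upper_of_commute {h : SLF} (hh : Commute (h * uniMat * h⁻¹) uniMat) : h 1 0 = 0 := by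
  set y := h * uniMat * h⁻¹ with hy
  have e : y * h = h * uniMat := by rw [hy]; group
  have a1 := congrArg (fun z : SLF => z 1 0) e
  have a2 := congrArg (fun z : SLF => z 1 1) e
  have a3 := congrArg (fun z : SLF => z 0 0) hh.eq
  simp only [sl_mul, uniMat, mkSL_00, mkSL_01, mkSL_10, mkSL_11] at a1 a2 a3
  have y0 : y 1 0 = 0 := by linear_combination -a3
  rw [y0] at a1 a2
  by_contra hne
  have : y 1 1 = 1 := by
    apply mul_right_cancel₀ hne
    linear_combination a1
  rw [this] at a2
  apply hne
  linear_combination -a2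

theorem borel_good {n : ℕ} (e : Multiplicative F ≃* (Fin n → Multiplicative (ZMod 2)))
    (u : Fˣ ≃* Multiplicative (ZMod (2 ^ n - 1)))
    (H : Subgroup SLF) (hH : ∀ h ∈ H, h 1 0 = 0) : Good n H := by
  let N := Fin n → Multiplicative (ZMod 2)
  let T := Multiplicative (ZMod (2 ^ n - 1))
  let ev : N → F := fun x => (e.symm x).toAdd
  have ev_mul : ∀ x y, ev (x * y) = ev x + ev y := fun x y => by simp [ev]
  let lam : T → F := fun s => (u.symm s : Fˣ)
  have lam_mul : ∀ x y, lam (x * y) = lam x * lam y := fun x y => by simp [lam]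
  have lam_one : lam 1 = 1 := by simp [lam]
  have lam_ne : ∀ x, lam x ≠ 0 := fun x => (u.symm x).ne_zero
  let act : T → N → N := fun s x => e (Multiplicative.ofAdd (lam s * lam s * ev x))
  have ev_act : ∀ s x, ev (act s x) = lam s * lam s * ev x := fun s x => by simp [ev, act]
  have ev_inj : ∀ x y, ev x = ev y → x = y := fun x y h => by
    apply e.symm.injective
    exact Multiplicative.toAdd.injective h
  have act_mul : ∀ s r x, act (s * r) x = act s (act r x) := fun s r x => by
    apply ev_inj; simp only [ev_act, lam_mul]; ring
  have act_one : ∀ x, act 1 x = x := fun x => by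
    apply ev_inj; simp only [ev_act, lam_one]; ring
  let φ : T →* MulAut N :=
    { toFun := fun s =>
        { toFun := act s
          invFun := act s⁻¹
          left_inv := fun x => by rw [← act_mul, inv_mul_cancel, act_one]
          right_inv := fun x => by rw [← act_mul, mul_inv_cancel, act_one]
          map_mul' := fun x y => by apply ev_inj; simp only [ev_act, ev_mul]; ring }
      map_one' := by
        apply MulEquiv.ext; intro x; exact act_one x
      map_mul' := fun s r => by
        apply MulEquiv.ext; intro x; exact act_mul s r x }
  let fn : N →* SLF := MonoidHom.mk' (fun x => mkSL 1 (ev x) 0 1 (by ring)) (fun x y => by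
    apply sl_ext <;> simp [sl_mul, ev_mul]
    try ring)
  let fg : T →* SLF := MonoidHom.mk' (fun s => mkSL (lam s) 0 0 (lam s)⁻¹ (by
      rw [mul_inv_cancel₀ (lam_ne s)]; ring)) (fun x y => by
    apply sl_ext <;> simp [sl_mul, lam_mul]
    try ring)
  have compat : ∀ g, fn.comp (φ g).toMonoidHom = (MulAut.conj (fg g)).toMonoidHom.comp fn := by
    intro s
    apply MonoidHom.ext
    intro x
    change fn (act s x) = fg s * fn x * (fg s)⁻¹
    rw [eq_mul_inv_iff_mul_eq]
    have := lam_ne s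
    apply sl_ext <;> simp [sl_mul, fn, fg, ev_act]
    field_simp
  let f := SemidirectProduct.lift fn fg compat
  have f_def : ∀ a, f a = fn a.left * fg a.right := fun a => rfl
  have hf : Function.Injective f := by
    rw [injective_iff_map_eq_one]
    intro a ha
    rw [f_def] at ha
    have h1 := congrArg (fun z : SLF => z 0 0) ha
    have h2 := congrArg (fun z : SLF => z 0 1) ha
    simp [sl_mul, fn, fg, lam_ne] at h1 h2
    apply SemidirectProduct.ext
    · apply ev_inj
      rw [h2]; simp [ev]
    · apply u.symm.injective
      apply Units.ext
      simpa [lam] using h1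
  refine ⟨f.range, ?_, Or.inr (Or.inr ⟨φ, ⟨(MonoidHom.ofInjective hf).symm⟩⟩)⟩
  intro h hh
  have h0 := hH h hh
  have hd := sl_det h
  rw [h0] at hd
  have hd' : h 0 0 * h 1 1 = 1 := by linear_combination hd
  have hne : h 0 0 ≠ 0 := left_ne_zero_of_mul_eq_one hd'
  refine ⟨⟨e (Multiplicative.ofAdd (h 0 1 * h 0 0)), u (Units.mk0 _ hne)⟩, ?_⟩
  rw [f_def]
  apply sl_ext <;> simp [sl_mul, fn, fg, ev, lam, h0]
  · field_simp
  · field_simp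
    linear_combination -hd'

theorem sl_good [Finite F] {n : ℕ} (hq : Nat.card F = 2 ^ n)
    (e : Multiplicative F ≃* (Fin n → Multiplicative (ZMod 2)))
    (u : Fˣ ≃* Multiplicative (ZMod (2 ^ n - 1)))
    (H : Subgroup SLF) (hs : IsSolvable H) : Good n H := by
  by_cases hb : H = ⊥
  · apply borel_good e u
    intro h hh
    rw [hb, Subgroup.mem_bot] at hh
    simp [hh]
  obtain ⟨g, -, hg1, hcomm⟩ := exists_commuting H hs hb
  have conjl : ∀ (P : SLF) (c : SLF), P * g * P⁻¹ = c →
      ∀ h ∈ H.map ((MulAut.conj P : SLF ≃* SLF) : SLF →* SLF), Commute (h * c * h⁻¹) c := by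
    rintro P c rfl _ ⟨h, hh, rfl⟩
    have h1 := (hcomm h hh).map (MulAut.conj P : SLF ≃* SLF)
    simpa [MulAut.conj_apply, mul_assoc] using h1
  obtain ⟨P, hP⟩ := exists_conj_cmp g hg1
  by_cases ht : g 0 0 + g 1 1 = 0
  · have hu1 : (uniMat : SLF) ≠ 1 := by
      intro h
      have := congrArg (fun z : SLF => z 0 1) h
      simp [uniMat] at this
    obtain ⟨Q, hQ⟩ := exists_conj_cmp (uniMat : SLF) hu1
    have hut : (uniMat : SLF) 0 0 + (uniMat : SLF) 1 1 = 0 := by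
      simp only [uniMat, mkSL_00, mkSL_11]
      linear_combination two0 (F := F)
    rw [hut] at hQ
    rw [ht, ← hQ] at hP
    have hR : (Q⁻¹ * P) * g * (Q⁻¹ * P)⁻¹ = uniMat := by
      calc (Q⁻¹ * P) * g * (Q⁻¹ * P)⁻¹ = Q⁻¹ * (P * g * P⁻¹) * Q := by group
        _ = uniMat := by rw [hP]; group
    apply Good.of_map (MulAut.conj (Q⁻¹ * P) : SLF ≃* SLF)
    exact borel_good e u _ (fun h hh => upper_of_commute (conjl _ _ hR h hh))
  · apply Good.of_map (MulAut.conj P : SLF ≃* SLF)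
    exact torus_good hq ht _ (conjl _ _ hP)

end SLTwo

theorem solvable_subgroup_PSL_two_char_two (n : ℕ) (hn : 2 ≤ n)
    (H : Subgroup (PSL 2 (GaloisField 2 n))) (hH : IsSolvable ↥H) :
    ∃ K : Subgroup (PSL 2 (GaloisField 2 n)), H ≤ K ∧
      (Nonempty (↥K ≃* DihedralGroup (2 ^ n - 1)) ∨
       Nonempty (↥K ≃* DihedralGroup (2 ^ n + 1)) ∨
       ∃ φ : Multiplicative (ZMod (2 ^ n - 1)) →* MulAut (Fin n → Multiplicative (ZMod 2)),
         Nonempty (↥K ≃* SemidirectProduct (Fin n → Multiplicative (ZMod 2))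
           (Multiplicative (ZMod (2 ^ n - 1))) φ)) := by
  have hn0 : n ≠ 0 := by omega
  have hq : Nat.card (GaloisField 2 n) = 2 ^ n := GaloisField.card 2 n hn0
  have hu : Nat.card (GaloisField 2 n)ˣ = 2 ^ n - 1 := by rw [Nat.card_units, hq]
  let u : (GaloisField 2 n)ˣ ≃* Multiplicative (ZMod (2 ^ n - 1)) :=
    mulEquivOfCyclicCardEq (by rw [hu]; exact (Nat.card_zmod _).symm)
  let b := Module.finBasisOfFinrankEq (ZMod 2) (GaloisField 2 n) (GaloisField.finrank 2 hn0)
  let e : Multiplicative (GaloisField 2 n) ≃* (Fin n → Multiplicative (ZMod 2)) :=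
    { toFun := fun x i => Multiplicative.ofAdd (b.equivFun x.toAdd i)
      invFun := fun y => Multiplicative.ofAdd (b.equivFun.symm fun i => (y i).toAdd)
      left_inv := fun x => by
        apply Multiplicative.toAdd.injective
        exact b.equivFun.symm_apply_apply x.toAdd
      right_inv := fun y => by
        funext i
        apply Multiplicative.toAdd.injective
        exact congrFun (b.equivFun.apply_symm_apply fun i => (y i).toAdd) i
      map_mul' := fun x y => by
        funext i
        apply Multiplicative.toAdd.injective
        exact congrFun (b.equivFun.map_add x.toAdd y.toAdd) i }
  let E : PSL 2 (GaloisField 2 n) ≃* Matrix.SpecialLinearGroup (Fin 2) (GaloisField 2 n) :=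
    (QuotientGroup.quotientMulEquivOfEq center_SL).trans QuotientGroup.quotientBot
  have hs : IsSolvable (H.map (E : PSL 2 (GaloisField 2 n) →*
      Matrix.SpecialLinearGroup (Fin 2) (GaloisField 2 n))) := by
    haveI : Group.IsSolvable H := hH
    have hsur : Function.Surjective (E.subgroupMap H).toMonoidHom := (E.subgroupMap H).surjective
    exact Group.isSolvable_of_surjective hsur
  exact Good.of_map E (sl_good hq e u _ hs)
end
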